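/- Let k ≥ 2 and let n_1 = n_1(p), …, n_k = n_k(p) be sequences of positive integers with n_i > p + 1 for all p ≥ 1 and p/n_i → y_i ∈ (0, 1] as p → ∞ for each 1 ≤ i ≤ k; set n = n_1 + ⋯ + n_k. For each p, let {y_{ij} : 1 ≤ i ≤ k, 1 ≤ j ≤ n_i} be independent ℝ^p-valued random vectors, each with independent standard normal coordinates. Define ȳ_i = (1/n_i)Σ_{j=1}^{n_i} y_{ij}, ȳ = (1/n)Σ_{i=1}^k n_i ȳ_i, B_i = Σ_{j=1}^{n_i}(y_{ij} − ȳ_i)(y_{ij} − ȳ_i)ᵀ, A = Σ_{i=1}^k n_i(ȳ_i − ȳ)(ȳ_i − ȳ)ᵀ, B = Σ_{i=1}^k B_i, and Λ_n = [∏_{i=1}^k det(B_i)^{n_i/2} / det(A + B)^{n/2}] · n^{pn/2} / ∏_{i=1}^k n_i^{p n_i/2}. With r_x = (−log(1 − p/x))^{1/2} for x > p and n_i' = n_i − 1, define μ_n = (1/4)[ −2kp − Σ_{i=1}^k y_i + n·r_n²·(2p − 2n + 3) − Σ_{i=1}^k n_i·r_{n_i'}²·(2p − 2n_i + 3) ]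 and σ_n² = (1/2)( Σ_{i=1}^k (n_i²/n²)·r_{n_i'}² − r_n² ), which is strictly positive. Then (log Λ_n − μ_n)/(n σ_n) converges in distribution to the standard normal distribution N(0,1) as p → ∞. -/

import Mathlib

open Filter Topology MeasureTheory ProbabilityTheory Matrix

/-- The logarithm of Wilks's likelihood ratio statistic for testing that `k`
`p`-variate normal distributions are identical, computed from the data array `ω`,
where `ω (⟨i, j⟩, c)` is the `c`-th coordinate of the `j`-th observation in group `i`
(group `i` has `nn i` observations):
`Λ = [∏_i det(B_i)^{n_i/2} / det(A+B)^{n/2}] · n^{pn/2} / ∏_i n_i^{p n_i/2}`. -/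
noncomputable def logIdenticalStat (k p : ℕ) (nn : Fin k → ℕ)
    (ω : ((i : Fin k) × Fin (nn i)) × Fin p → ℝ) : ℝ :=
  let n : ℝ := ∑ i, (nn i : ℝ)
  let ybar : Fin k → Fin p → ℝ := fun i c => (∑ j, ω (⟨i, j⟩, c)) / (nn i)
  let gbar : Fin p → ℝ := fun c => (∑ i, (nn i : ℝ) * ybar i c) / n
  let B : Fin k → Matrix (Fin p) (Fin p) ℝ := fun i =>
    ∑ j, Matrix.vecMulVec (fun c => ω (⟨i, j⟩, c) - ybar i c)
      (fun c => ω (⟨i, j⟩, c) - ybar i c)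
  let A : Matrix (Fin p) (Fin p) ℝ :=
    ∑ i, (nn i : ℝ) • Matrix.vecMulVec (fun c => ybar i c - gbar c)
      (fun c => ybar i c - gbar c)
  Real.log ((∏ i, (B i).det ^ ((nn i : ℝ) / 2)) / (A + ∑ i, B i).det ^ (n / 2)
    * (n ^ ((p : ℝ) * n / 2) / ∏ i, (nn i : ℝ) ^ ((p : ℝ) * (nn i) / 2)))

namespace JY

/-- `F` is multiplicatively close to one. -/
def Near (F : ℂ) (x : ℝ) : Prop := ‖F - 1‖ ≤ Real.exp x - 1

lemma Near.mono {F : ℂ} {x y : ℝ} (h : Near F x) (hxy : x ≤ y) : Near F y :=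
  le_trans h (sub_le_sub_right (Real.exp_le_exp.2 hxy) 1)

lemma Near.mul {F G : ℂ} {x y : ℝ} (hF : Near F x) (hG : Near G y) : Near (F * G) (x + y) := by
  unfold Near at *
  have h1 : F * G - 1 = (F - 1) * (G - 1) + (F - 1) + (G - 1) := by ring
  rw [h1, Real.exp_add]
  have h2 : ‖(F - 1) * (G - 1) + (F - 1) + (G - 1)‖ ≤ ‖F - 1‖ * ‖G - 1‖ + ‖F - 1‖ + ‖G - 1‖ := by
    refine (norm_add_le _ _).trans ?_
    gcongr
    refine (norm_add_le _ _).trans ?_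
    rw [norm_mul]
  refine h2.trans ?_
  have := mul_le_mul hF hG (norm_nonneg _) (le_trans (norm_nonneg _) hF)
  nlinarith

lemma Near.prod {ι : Type*} (t : Finset ι) {F : ι → ℂ} {x : ι → ℝ}
    (h : ∀ i ∈ t, Near (F i) (x i)) : Near (∏ i ∈ t, F i) (∑ i ∈ t, x i) := by
  classical
  induction t using Finset.induction_on with
  | empty => simp [Near]
  | insert a t ha ih =>
    rw [Finset.prod_insert ha, Finset.sum_insert ha]
    exact (h a (Finset.mem_insert_self _ _)).mul
      (ih fun i hi => h i (Finset.mem_insert_of_mem hi))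

lemma near_exp (w : ℂ) : Near (Complex.exp w) ‖w‖ := by
  have := Complex.norm_exp_sub_sum_le_exp_norm_sub_sum w 1
  simpa [Near] using this

lemma Near.tendsto {α : Type*} {l : Filter α} {F : α → ℂ} {x : α → ℝ}
    (h : ∀ᶠ a in l, Near (F a) (x a)) (hx : Tendsto x l (𝓝 0)) : Tendsto F l (𝓝 1) := by
  rw [tendsto_iff_norm_sub_tendsto_zero]
  refine squeeze_zero' (Eventually.of_forall fun _ => norm_nonneg _) h ?_
  have : Tendsto (fun a => Real.exp (x a) - 1) l (𝓝 (Real.exp 0 - 1)) :=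
    ((Real.continuous_exp.tendsto 0).comp hx).sub_const 1
  simpa using this

lemma log_approx {x : ℝ} (hx0 : 0 ≤ x) (hx : x ≤ 1 / 2) :
    |x + x ^ 2 / 2 + Real.log (1 - x)| ≤ 2 * x ^ 3 := by
  have h := Real.abs_log_sub_add_sum_range_le (x := x) (by rw [abs_of_nonneg hx0]; linarith) 2
  rw [abs_of_nonneg hx0] at h
  simp only [Finset.sum_range_succ, Finset.sum_range_zero] at h
  norm_num at h
  refine h.trans ?_
  rw [div_le_iff₀ (by linarith)]
  nlinarith [pow_nonneg hx0 3]

/-- main term -/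
noncomputable def mainT (s z : ℝ) : ℂ :=
  ((s * (Real.log z - 1 / (2 * z)) : ℝ) : ℂ) * Complex.I - ((s ^ 2 / (2 * z) : ℝ) : ℂ)

noncomputable def rho (s z : ℝ) : ℂ :=
  Complex.log (1 + ((s / z : ℝ) : ℂ) * Complex.I) + mainT s z - mainT s (z + 1)

lemma rho_bound {S s z : ℝ} (hz : 1 ≤ z) (hsS : |s| ≤ S) (hs : |s| ≤ z / 2) :
    ‖rho s z‖ ≤ (S ^ 2 + S + 3) * |s| / z ^ 3 := by
  have hz0 : 0 < z := by linarith
  set w : ℂ := ((s / z : ℝ) : ℂ) * Complex.I with hw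
  have hwn : ‖w‖ = |s| / z := by
    rw [hw, norm_mul, Complex.norm_I, mul_one, Complex.norm_real, Real.norm_eq_abs, abs_div,
      abs_of_pos hz0]
  have hw2 : ‖w‖ ≤ 1 / 2 := by
    rw [hwn, div_le_iff₀ hz0]; linarith
  have h1 := Complex.norm_log_sub_logTaylor_le 2 (z := w) (by linarith)
  have h2 : Complex.logTaylor (2 + 1) w = w - w ^ 2 / 2 := by
    simp [Complex.logTaylor_succ, Complex.logTaylor_zero]
    ring
  rw [h2] at h1
  have h1' : ‖Complex.log (1 + w) - (w - w ^ 2 / 2)‖ ≤ |s| ^ 3 / z ^ 3 := by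
    refine h1.trans ?_
    have : ‖w‖ ^ (2 + 1) = |s| ^ 3 / z ^ 3 := by rw [hwn, div_pow]
    rw [this]
    have h3 : (1 - ‖w‖)⁻¹ ≤ 2 := by
      rw [inv_le_comm₀ (by linarith) (by norm_num)]; linarith
    have h4 : 0 ≤ |s| ^ 3 / z ^ 3 := by positivity
    have := mul_le_mul_of_nonneg_left h3 h4
    rw [div_le_iff₀ (by positivity)]
    push_cast
    linarith
  -- real parts
  set e : ℝ := 1 / z - 1 / (2 * z) + 1 / (2 * (z + 1)) + Real.log z - Real.log (z + 1) with he
  have heb : |e| ≤ 3 / z ^ 3 := by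
    have hx := log_approx (x := 1 / (z + 1)) (by positivity)
      (by rw [div_le_div_iff₀ (by linarith) (by norm_num)]; linarith)
    have hl : Real.log (1 - 1 / (z + 1)) = Real.log z - Real.log (z + 1) := by
      rw [← Real.log_div (by positivity) (by positivity)]
      congr 1; field_simp; ring
    rw [hl] at hx
    have h5 : e = (1 / (z + 1) + (1 / (z + 1)) ^ 2 / 2 + (Real.log z - Real.log (z + 1)))
        + 1 / (2 * z * (z + 1) ^ 2) := by
      rw [he]; field_simp; ring
    rw [h5]
    refine (abs_add_le _ _).trans ?_
    have h6 : (1 / (z + 1)) ^ 3 ≤ 1 / z ^ 3 := by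
      rw [div_pow, one_pow]
      gcongr; linarith
    have h7 : |1 / (2 * z * (z + 1) ^ 2)| ≤ 1 / z ^ 3 := by
      rw [abs_of_pos (by positivity)]
      gcongr
      nlinarith [mul_pos hz0 hz0, pow_pos hz0 3]
    have h8 : 3 / z ^ 3 = 2 * (1 / z ^ 3) + 1 / z ^ 3 := by ring
    rw [h8]
    linarith
  have hdec : rho s z = (Complex.log (1 + w) - (w - w ^ 2 / 2)) + ((s * e : ℝ) : ℂ) * Complex.I
      + ((s ^ 2 / 2 * (1 / (z ^ 2 * (z + 1))) : ℝ) : ℂ) := by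
    have hw2' : w ^ 2 = ((-(s / z) ^ 2 : ℝ) : ℂ) := by
      rw [hw, mul_pow, Complex.I_sq]; push_cast; ring
    have hr : s ^ 2 / 2 * (1 / (z ^ 2 * (z + 1))) =
      -(s / z) ^ 2 / 2 * (-1) - s ^ 2 / (2 * z) + s ^ 2 / (2 * (z + 1)) := by
      field_simp; ring
    rw [hr, hw2', rho, mainT, mainT, ← hw]
    have hse : s * e = s / z + s * (Real.log z - 1 / (2 * z)) -
       s * (Real.log (z + 1) - 1 / (2 * (z + 1))) := by
      rw [he]; field_simp; ring
    rw [hse, hw]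
    push_cast
    ring
  rw [hdec]
  have hb3 : ‖((s ^ 2 / 2 * (1 / (z ^ 2 * (z + 1))) : ℝ) : ℂ)‖ ≤ |s| ^ 2 / z ^ 3 := by
    rw [Complex.norm_real, Real.norm_eq_abs, abs_of_nonneg (by positivity), sq_abs]
    have : 1 / (z ^ 2 * (z + 1)) ≤ 1 / z ^ 3 := by
      gcongr; nlinarith [mul_pos hz0 hz0]
    have := mul_le_mul_of_nonneg_left this (by positivity : 0 ≤ s ^ 2 / 2)
    have h9 : s ^ 2 / 2 * (1 / z ^ 3) ≤ s ^ 2 / z ^ 3 := by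
      have : 0 ≤ s ^ 2 / z ^ 3 := by positivity
      have : s ^ 2 / 2 * (1 / z ^ 3) = s ^ 2 / z ^ 3 / 2 := by ring
      linarith
    linarith
  have hb2 : ‖((s * e : ℝ) : ℂ) * Complex.I‖ ≤ |s| * (3 / z ^ 3) := by
    rw [norm_mul, Complex.norm_I, mul_one, Complex.norm_real, Real.norm_eq_abs, abs_mul]
    gcongr
  refine (norm_add₃_le).trans ?_
  have hA : |s| ^ 3 / z ^ 3 ≤ S ^ 2 * |s| / z ^ 3 := by
    gcongr
    have : |s| ^ 3 = |s| ^ 2 * |s| := by ring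
    rw [this]; gcongr
  have hB : |s| ^ 2 / z ^ 3 ≤ S * |s| / z ^ 3 := by
    gcongr
    rw [pow_two]; gcongr
  have : (S ^ 2 + S + 3) * |s| / z ^ 3 = S ^ 2 * |s| / z ^ 3 + S * |s| / z ^ 3 + |s| * (3 / z ^ 3) := by
    ring
  linarith

lemma sum_cube_bound {z : ℝ} (hz : 1 ≤ z) (n : ℕ) :
    ∑ l ∈ Finset.range n, 1 / (z + l) ^ 3 ≤ 2 / z ^ 2 - 2 / (z + n) ^ 2 := by
  induction n with
  | zero => simp
  | succ n ih =>
    rw [Finset.sum_range_succ]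
    have hx : 1 ≤ z + n := by have : (0 : ℝ) ≤ n := Nat.cast_nonneg n; linarith
    push_cast
    rw [← add_assoc]
    set x := z + (n : ℝ)
    have hx0 : 0 < x := by linarith
    have : 1 / x ^ 3 ≤ 2 / x ^ 2 - 2 / (x + 1) ^ 2 := by
      rw [div_sub_div _ _ (by positivity) (by positivity), div_le_div_iff₀ (by positivity) (by positivity)]
      have : (2 * (x + 1) ^ 2 - x ^ 2 * 2) * x ^ 3 - 1 * (x ^ 2 * (x + 1) ^ 2) = x ^ 2 * (3 * x ^ 2 - 1) := by
        ring
      have h2 : 0 ≤ x ^ 2 * (3 * x ^ 2 - 1) := by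
        apply mul_nonneg (by positivity); nlinarith
      linarith
    linarith

lemma gamma_near {S s z : ℝ} (hz : 1 ≤ z) (hsS : |s| ≤ S) (hs : |s| ≤ z / 2) :
    Near (Complex.Gamma (z + s * Complex.I) / Complex.Gamma z * Complex.exp (-mainT s z))
      (2 * (S ^ 2 + S + 3) * |s| / z ^ 2) := by
  have hz0 : 0 < z := by linarith
  have hG : Complex.Gamma z ≠ 0 := Complex.Gamma_ne_zero_of_re_pos (by simpa using hz0)
  have hS : 0 ≤ S := (abs_nonneg s).trans hsS
  have ht := ((Complex.GammaSeq_tendsto_Gamma (z + s * Complex.I)).div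
    (Complex.GammaSeq_tendsto_Gamma z) hG).mul_const (Complex.exp (-mainT s z))
  -- correction factor
  set c : ℕ → ℂ := fun N => Complex.exp
    (((s * (Real.log N - Real.log (z + (N + 1))) + s / (2 * (z + (N + 1))) : ℝ) : ℂ) * Complex.I
      + ((s ^ 2 / (2 * (z + (N + 1))) : ℝ) : ℂ)) with hc
  have hinv : Tendsto (fun N : ℕ => 1 / (z + ((N : ℝ) + 1))) atTop (𝓝 0) := by
    have : Tendsto (fun N : ℕ => z + ((N : ℝ) + 1)) atTop atTop :=
      tendsto_atTop_add_const_left _ _ (tendsto_atTop_add_const_right _ _ tendsto_natCast_atTop_atTop)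
    simpa [Pi.inv_def] using this.inv_tendsto_atTop
  have hcl : Tendsto c atTop (𝓝 1) := by
    have hl : Tendsto (fun N : ℕ => Real.log N - Real.log (z + (N + 1))) atTop (𝓝 0) := by
      have h1 : Tendsto (fun N : ℕ => 1 - (z + 1) * (1 / (z + ((N : ℝ) + 1)))) atTop (𝓝 1) := by
        simpa using (hinv.const_mul (z + 1)).const_sub 1
      have h2 := (Real.continuousAt_log (x := 1) one_ne_zero).tendsto.comp h1
      rw [Real.log_one] at h2
      refine h2.congr' ?_
      filter_upwards [eventually_ge_atTop 1] with N hN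
      have hN0 : (0 : ℝ) < N := by exact_mod_cast hN
      simp only [Function.comp]
      rw [← Real.log_div hN0.ne' (by positivity)]
      congr 1; field_simp; ring
    have hr1 : Tendsto (fun N : ℕ => s * (Real.log N - Real.log (z + (N + 1))) + s / (2 * (z + (N + 1))))
        atTop (𝓝 0) := by
      have := (hl.const_mul s).add (hinv.const_mul (s / 2))
      simp only [mul_zero, add_zero] at this
      refine this.congr fun N => ?_
      congr 1
      have : (0:ℝ) < z + (N + 1) := by positivity
      field_simp
    have hr2 : Tendsto (fun N : ℕ => s ^ 2 / (2 * (z + ((N : ℝ) + 1)))) atTop (𝓝 0) := by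
      have := (hinv.const_mul (s ^ 2 / 2))
      simp only [mul_zero] at this
      refine this.congr fun N => ?_
      have : (0:ℝ) < z + (N + 1) := by positivity
      field_simp
    have h3 := (((Complex.continuous_ofReal.tendsto 0).comp hr1).mul_const Complex.I).add
      ((Complex.continuous_ofReal.tendsto 0).comp hr2)
    have h4 := (Complex.continuous_exp.tendsto _).comp h3
    simpa [Function.comp_def, hc] using h4
  have hform : ∀ N : ℕ, 1 ≤ N → Complex.GammaSeq (z + s * Complex.I) N / Complex.GammaSeq z N *
      Complex.exp (-mainT s z) = (∏ l ∈ Finset.range (N + 1), Complex.exp (-rho s (z + l))) * c N := by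
    intro N hN
    have hN0 : (0 : ℝ) < N := by exact_mod_cast hN
    have hNc : (N : ℂ) ≠ 0 := by exact_mod_cast hN0.ne'
    have hfac : ((Nat.factorial N : ℕ) : ℂ) ≠ 0 := by exact_mod_cast Nat.factorial_ne_zero N
    have hpow : (N : ℂ) ^ ((z : ℂ) + s * Complex.I) = (N : ℂ) ^ (z : ℂ) *
        Complex.exp (((s * Real.log N : ℝ) : ℂ) * Complex.I) := by
      rw [Complex.cpow_add _ _ hNc]
      congr 1
      rw [Complex.cpow_def_of_ne_zero hNc, ← Complex.natCast_log]
      congr 1; push_cast; ring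
    have hNz : (N : ℂ) ^ (z : ℂ) ≠ 0 := by
      rw [Complex.cpow_def_of_ne_zero hNc]; exact Complex.exp_ne_zero _
    have hpos : ∀ l : ℕ, (0 : ℝ) < z + l := fun l => by positivity
    have hrho : ∀ l : ℕ, Complex.exp (-rho s (z + l)) =
        ((z : ℂ) + l) / (z + s * Complex.I + l) * Complex.exp (mainT s (z + (l + 1 : ℕ)) - mainT s (z + l)) := by
      intro l
      have hne : (1 + ((s / (z + l) : ℝ) : ℂ) * Complex.I) ≠ 0 := by
        intro h
        have := congrArg Complex.re h
        rw [Complex.add_re, Complex.re_ofReal_mul] at this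
        simp at this
      have hzl : (z : ℂ) + l ≠ 0 := by exact_mod_cast (hpos l).ne'
      have hne2 : (z : ℂ) + s * Complex.I + l ≠ 0 := by
        intro h; have := congrArg Complex.re h; simp at this; exact (hpos l).ne' this
      have : -rho s (z + l) = -Complex.log (1 + ((s / (z + l) : ℝ) : ℂ) * Complex.I) +
          (mainT s (z + (l + 1 : ℕ)) - mainT s (z + l)) := by
        rw [rho]; push_cast; rw [add_assoc z]; ring
      rw [this, Complex.exp_add, Complex.exp_neg, Complex.exp_log hne]
      congr 1
      push_cast
      field_simp
      rw [div_eq_one_iff_eq (by rw [add_right_comm]; exact hne2)]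
      ring
    have htel : ∀ M : ℕ, ∏ l ∈ Finset.range M, Complex.exp (-rho s (z + l)) =
        (∏ l ∈ Finset.range M, ((z : ℂ) + l)) / (∏ l ∈ Finset.range M, ((z : ℂ) + s * Complex.I + l)) *
          Complex.exp (mainT s (z + M) - mainT s z) := by
      intro M
      induction M with
      | zero => simp
      | succ M ih =>
        rw [Finset.prod_range_succ, ih, Finset.prod_range_succ, Finset.prod_range_succ, hrho]
        rw [show mainT s (z + (M + 1 : ℕ)) - mainT s z = (mainT s (z + M) - mainT s z) +
          (mainT s (z + (M + 1 : ℕ)) - mainT s (z + M)) by ring, Complex.exp_add (mainT s (z + M) - mainT s z)]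
        rw [mul_div_mul_comm]
        ring
    rw [htel, Complex.GammaSeq, Complex.GammaSeq, hpow]
    have hp1 : ∏ l ∈ Finset.range (N + 1), ((z : ℂ) + l) ≠ 0 :=
      Finset.prod_ne_zero_iff.2 fun l _ => by exact_mod_cast (hpos l).ne'
    have hp2 : ∏ l ∈ Finset.range (N + 1), ((z : ℂ) + s * Complex.I + l) ≠ 0 :=
      Finset.prod_ne_zero_iff.2 fun l _ => by
        intro h; have := congrArg Complex.re h; simp at this; exact (hpos l).ne' this
    have hce : Complex.exp (mainT s (z + (N + 1 : ℕ)) - mainT s z) * c N =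
        Complex.exp (((s * Real.log N : ℝ) : ℂ) * Complex.I) * Complex.exp (-mainT s z) := by
      rw [hc]
      simp only
      rw [← Complex.exp_add, ← Complex.exp_add]
      congr 1
      have hx : (0:ℝ) < z + (N + 1) := by positivity
      have : s * (Real.log N) = s * (Real.log (z + (N + 1)) - 1 / (2 * (z + (N + 1)))) +
        (s * (Real.log N - Real.log (z + (N + 1))) + s / (2 * (z + (N + 1)))) := by field_simp; ring
      rw [this, mainT]
      push_cast
      ring
    rw [mul_assoc (_ / _) _ (c N), hce]
    field_simp
  have hnear : ∀ N : ℕ, Near (∏ l ∈ Finset.range (N + 1), Complex.exp (-rho s (z + l)))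
      (2 * (S ^ 2 + S + 3) * |s| / z ^ 2) := by
    intro N
    refine (Near.prod _ fun l _ => near_exp _).mono ?_
    have : ∀ l ∈ Finset.range (N + 1), ‖-rho s (z + l)‖ ≤ (S ^ 2 + S + 3) * |s| * (1 / (z + l) ^ 3) := by
      intro l _
      have hl : (0 : ℝ) ≤ l := Nat.cast_nonneg l
      rw [norm_neg]
      refine (rho_bound (S := S) (by linarith) hsS (by linarith)).trans (le_of_eq (by ring))
    refine (Finset.sum_le_sum this).trans ?_
    rw [← Finset.mul_sum]
    have h1 := sum_cube_bound hz (N + 1)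
    have h2 : ∑ l ∈ Finset.range (N + 1), 1 / (z + l) ^ 3 ≤ 2 / z ^ 2 := by
      refine h1.trans ?_
      have : 0 ≤ 2 / (z + (N + 1 : ℕ)) ^ 2 := by positivity
      linarith
    refine (mul_le_mul_of_nonneg_left h2 (by positivity)).trans (le_of_eq (by ring))
  have hprod : Tendsto (fun N : ℕ => ∏ l ∈ Finset.range (N + 1), Complex.exp (-rho s (z + l))) atTop
      (𝓝 (Complex.Gamma (z + s * Complex.I) / Complex.Gamma z * Complex.exp (-mainT s z))) := by
    have h1 := ht.div hcl one_ne_zero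
    rw [div_one] at h1
    refine h1.congr' ?_
    filter_upwards [eventually_ge_atTop 1] with N hN
    have hcN : c N ≠ 0 := Complex.exp_ne_zero _
    simp only [Pi.div_apply]
    rw [hform N hN, mul_div_assoc, div_self hcN, mul_one]
  exact le_of_tendsto (hprod.sub_const 1).norm (Eventually.of_forall hnear)

end JY

namespace JY

noncomputable def GR (s : ℝ) (d p : ℕ) : ℂ :=
  ∏ j ∈ Finset.range p, (Complex.Gamma (((((d : ℝ) + 1 + j) / 2 : ℝ) : ℂ) + s * Complex.I) /
    Complex.Gamma ((((d : ℝ) + 1 + j) / 2 : ℝ) : ℂ))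

noncomputable def phA (d p : ℝ) : ℝ :=
  -p * Real.log 2 + (d + p - 1 / 2) * Real.log (d + p) - (d - 1 / 2) * Real.log d - p

noncomputable def LL (d p : ℝ) : ℝ := Real.log (d + p) - Real.log d

lemma step_h {N : ℝ} (hN : 1 ≤ N) : ∃ e : ℝ, |e| ≤ 2 * (1 / (N + 1)) ^ 3 ∧
    Real.log N = Real.log (N + 1) - (1 / (N + 1) + (1 / (N + 1)) ^ 2 / 2 + e) := by
  have hx := log_approx (x := 1 / (N + 1)) (by positivity)
      (by rw [div_le_div_iff₀ (by linarith) (by norm_num)]; linarith)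
  have hl : Real.log (1 - 1 / (N + 1)) = Real.log N - Real.log (N + 1) := by
    rw [← Real.log_div (by positivity) (by positivity)]
    congr 1; field_simp; ring
  rw [hl] at hx
  refine ⟨-(1 / (N + 1) + (1 / (N + 1)) ^ 2 / 2 + (Real.log N - Real.log (N + 1))), by rwa [abs_neg], by ring⟩

lemma step_tel {N : ℝ} (hN : 1 ≤ N) : (1 / (N + 1)) ^ 2 ≤ 1 / N - 1 / (N + 1) := by
  rw [div_pow, one_pow, div_sub_div _ _ (by positivity) (by positivity),
    div_le_div_iff₀ (by positivity) (by positivity)]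
  nlinarith

lemma sumA_bound {d : ℕ} (hd : 1 ≤ d) (p : ℕ) :
    |∑ j ∈ Finset.range p, (Real.log (((d : ℝ) + 1 + j) / 2) - 1 / (2 * (((d : ℝ) + 1 + j) / 2))) - phA d p|
      ≤ 5 * (1 / (d : ℝ) - 1 / (d + p)) := by
  have hd1 : (1 : ℝ) ≤ d := by exact_mod_cast hd
  induction p with
  | zero => simp [phA]
  | succ p ih =>
    rw [Finset.sum_range_succ]
    set T := ∑ j ∈ Finset.range p, (Real.log (((d : ℝ) + 1 + j) / 2) - 1 / (2 * (((d : ℝ) + 1 + j) / 2)))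
    have hp : (0 : ℝ) ≤ p := Nat.cast_nonneg p
    have hN : (1 : ℝ) ≤ d + p := by linarith
    obtain ⟨e, he, hl⟩ := step_h hN
    have ht := step_tel hN
    have hlog : Real.log (((d : ℝ) + 1 + p) / 2) = Real.log ((d : ℝ) + p + 1) - Real.log 2 := by
      rw [Real.log_div (by positivity) (by norm_num)]; congr 2; ring
    set N : ℝ := (d : ℝ) + p with hNd
    have hN1 : (d : ℝ) + ((p + 1 : ℕ) : ℝ) = N + 1 := by push_cast; rw [hNd]; ring
    have hN2 : (d : ℝ) + 1 + p = N + 1 := by rw [hNd]; ring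
    have key : T + (Real.log (((d : ℝ) + 1 + p) / 2) - 1 / (2 * (((d : ℝ) + 1 + p) / 2))) - phA d (p + 1 : ℕ)
        = (T - phA d p) + (3 / 4 * (1 / (N + 1)) ^ 2 - (N - 1 / 2) * e) := by
      rw [hlog, phA, phA, hN1, ← hNd, hl, hN2]
      push_cast
      have : N + 1 ≠ 0 := by positivity
      field_simp
      ring
    rw [key, hN1]
    refine (abs_add_le _ _).trans ?_
    have h1 : |3 / 4 * (1 / (N + 1)) ^ 2 - (N - 1 / 2) * e| ≤ 5 * (1 / (N + 1)) ^ 2 := by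
      refine (abs_sub _ _).trans ?_
      rw [abs_mul, abs_mul, abs_of_nonneg (by linarith : 0 ≤ N - 1 / 2), abs_of_nonneg (by norm_num : (0:ℝ) ≤ 3 / 4),
        abs_of_nonneg (by positivity)]
      have h2 : (N - 1 / 2) * |e| ≤ (N + 1) * (2 * (1 / (N + 1)) ^ 3) := by
        gcongr
        linarith
      have h3 : (N + 1) * (2 * (1 / (N + 1)) ^ 3) = 2 * (1 / (N + 1)) ^ 2 := by field_simp
      nlinarith [sq_nonneg (1 / (N + 1))]
    linarith

lemma sumL_bound {d : ℕ} (hd : 1 ≤ d) (p : ℕ) :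
    |∑ j ∈ Finset.range p, 1 / (2 * (((d : ℝ) + 1 + j) / 2)) - LL d p|
      ≤ 2 * (1 / (d : ℝ) - 1 / (d + p)) := by
  have hd1 : (1 : ℝ) ≤ d := by exact_mod_cast hd
  induction p with
  | zero => simp [LL]
  | succ p ih =>
    rw [Finset.sum_range_succ]
    set T := ∑ j ∈ Finset.range p, 1 / (2 * (((d : ℝ) + 1 + j) / 2))
    have hp : (0 : ℝ) ≤ p := Nat.cast_nonneg p
    have hN : (1 : ℝ) ≤ d + p := by linarith
    obtain ⟨e, he, hl⟩ := step_h hN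
    have ht := step_tel hN
    set N : ℝ := (d : ℝ) + p with hNd
    have hN1 : (d : ℝ) + ((p + 1 : ℕ) : ℝ) = N + 1 := by push_cast; rw [hNd]; ring
    have hN2 : (d : ℝ) + 1 + p = N + 1 := by rw [hNd]; ring
    have key : T + 1 / (2 * (((d : ℝ) + 1 + p) / 2)) - LL d (p + 1 : ℕ)
        = (T - LL d p) - (1 / 2 * (1 / (N + 1)) ^ 2 + e) := by
      rw [LL, LL, hN1, ← hNd, hl, hN2]
      have : N + 1 ≠ 0 := by positivity
      field_simp
      ring
    rw [key, hN1]
    refine (abs_sub _ _).trans ?_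
    have h1 : |1 / 2 * (1 / (N + 1)) ^ 2 + e| ≤ 2 * (1 / (N + 1)) ^ 2 := by
      refine (abs_add_le _ _).trans ?_
      rw [abs_of_nonneg (by positivity : 0 ≤ 1 / 2 * (1 / (N + 1)) ^ 2)]
      have h2 : 1 / (N + 1) ≤ 1 / 2 := by gcongr; linarith
      have h3 : (1 / (N + 1)) ^ 3 ≤ 1 / 2 * (1 / (N + 1)) ^ 2 := by
        rw [pow_succ']; gcongr
      nlinarith [sq_nonneg (1 / (N + 1))]
    linarith

lemma sum_sq_bound {d : ℕ} (hd : 1 ≤ d) (p : ℕ) :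
    ∑ j ∈ Finset.range p, 1 / (((d : ℝ) + 1 + j) / 2) ^ 2 ≤ 4 * (1 / (d : ℝ) - 1 / (d + p)) := by
  have hd1 : (1 : ℝ) ≤ d := by exact_mod_cast hd
  induction p with
  | zero => simp
  | succ p ih =>
    rw [Finset.sum_range_succ]
    have hp : (0 : ℝ) ≤ p := Nat.cast_nonneg p
    have hN : (1 : ℝ) ≤ d + p := by linarith
    have ht := step_tel hN
    have h1 : 1 / (((d : ℝ) + 1 + p) / 2) ^ 2 = 4 * (1 / ((d : ℝ) + p + 1)) ^ 2 := by
      rw [add_right_comm]; field_simp; norm_num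
    rw [h1]; push_cast; rw [← add_assoc]
    linarith

noncomputable def KK (S : ℝ) : ℝ := 8 * (S ^ 2 + S + 3) + 5 + 2 * S

lemma GR_near {S s : ℝ} {d : ℕ} (hd : 1 ≤ d) (p : ℕ) (hsS : |s| ≤ S) (hs : |s| ≤ d / 4) :
    Near (GR s d p * Complex.exp (-(((s * phA d p : ℝ) : ℂ) * Complex.I) + ((s ^ 2 * LL d p : ℝ) : ℂ)))
      (KK S * (|s| / d)) := by
  have hd1 : (1 : ℝ) ≤ d := by exact_mod_cast hd
  have hS : 0 ≤ S := (abs_nonneg s).trans hsS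
  set z : ℕ → ℝ := fun j => ((d : ℝ) + 1 + j) / 2 with hz
  have hfac : GR s d p * Complex.exp (-(((s * phA d p : ℝ) : ℂ) * Complex.I) + ((s ^ 2 * LL d p : ℝ) : ℂ)) =
      (∏ j ∈ Finset.range p, (Complex.Gamma ((z j : ℂ) + s * Complex.I) / Complex.Gamma (z j : ℂ) *
        Complex.exp (-mainT s (z j)))) *
      Complex.exp (((s * (∑ j ∈ Finset.range p, (Real.log (z j) - 1 / (2 * z j)) - phA d p) : ℝ) : ℂ) * Complex.I
        - ((s ^ 2 * (∑ j ∈ Finset.range p, 1 / (2 * z j) - LL d p) : ℝ) : ℂ)) := by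
    rw [Finset.prod_mul_distrib, ← Complex.exp_sum, GR, mul_assoc, ← Complex.exp_add]
    congr 2
    have : ∑ j ∈ Finset.range p, -mainT s (z j) =
        -(((s * ∑ j ∈ Finset.range p, (Real.log (z j) - 1 / (2 * z j)) : ℝ) : ℂ) * Complex.I) +
        ((s ^ 2 * ∑ j ∈ Finset.range p, 1 / (2 * z j) : ℝ) : ℂ) := by
      simp only [Finset.mul_sum]
      push_cast
      rw [Finset.sum_mul, ← Finset.sum_neg_distrib, ← Finset.sum_add_distrib]
      refine Finset.sum_congr rfl fun j _ => ?_
      rw [mainT]; push_cast; ring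
    rw [this]
    push_cast
    ring
  rw [hfac]
  have h1 : Near (∏ j ∈ Finset.range p, (Complex.Gamma ((z j : ℂ) + s * Complex.I) / Complex.Gamma (z j : ℂ) *
        Complex.exp (-mainT s (z j)))) (8 * (S ^ 2 + S + 3) * (|s| / d)) := by
    refine (Near.prod _ (x := fun j => 2 * (S ^ 2 + S + 3) * |s| / (z j) ^ 2) fun j _ => ?_).mono ?_
    · have hj : (0 : ℝ) ≤ j := Nat.cast_nonneg j
      refine gamma_near ?_ hsS ?_
      · simp only [hz]; linarith
      · simp only [hz]; linarith
    · have h2 := sum_sq_bound hd p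
      have h3 : ∑ j ∈ Finset.range p, 1 / (z j) ^ 2 ≤ 4 / (d : ℝ) := by
        refine h2.trans ?_
        have : 0 ≤ 1 / ((d : ℝ) + p) := by positivity
        have : (4 : ℝ) / d = 4 * (1 / d) := by ring
        linarith
      have h4 : ∑ j ∈ Finset.range p, 2 * (S ^ 2 + S + 3) * |s| / (z j) ^ 2 =
          2 * (S ^ 2 + S + 3) * |s| * ∑ j ∈ Finset.range p, 1 / (z j) ^ 2 := by
        rw [Finset.mul_sum]; refine Finset.sum_congr rfl fun j _ => by ring
      rw [h4]
      refine (mul_le_mul_of_nonneg_left h3 (by positivity)).trans (le_of_eq (by ring))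
  have hq : 0 ≤ 1 / ((d : ℝ) + p) := by positivity
  have h2 : ‖((s * (∑ j ∈ Finset.range p, (Real.log (z j) - 1 / (2 * z j)) - phA d p) : ℝ) : ℂ) * Complex.I
        - ((s ^ 2 * (∑ j ∈ Finset.range p, 1 / (2 * z j) - LL d p) : ℝ) : ℂ)‖ ≤ (5 + 2 * S) * (|s| / d) := by
    refine (norm_sub_le _ _).trans ?_
    rw [norm_mul, Complex.norm_I, mul_one, Complex.norm_real, Complex.norm_real, Real.norm_eq_abs,
      Real.norm_eq_abs, abs_mul, abs_mul]
    have h5 := sumA_bound hd p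
    have h6 := sumL_bound hd p
    have h7 : |∑ j ∈ Finset.range p, (Real.log (z j) - 1 / (2 * z j)) - phA d p| ≤ 5 * (1 / d) := by
      refine h5.trans ?_; linarith
    have h8 : |∑ j ∈ Finset.range p, 1 / (2 * z j) - LL d p| ≤ 2 * (1 / d) := by
      refine h6.trans ?_; linarith
    have h9 : |s ^ 2| ≤ S * |s| := by rw [abs_pow, pow_two]; gcongr
    calc _ ≤ |s| * (5 * (1 / d)) + (S * |s|) * (2 * (1 / d)) := by gcongr
      _ = _ := by ring
  refine (h1.mul ((near_exp _).mono h2)).mono (le_of_eq ?_)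
  rw [KK]; ring

end JY

namespace JY
section dens
open Complex Module
open scoped RealInnerProductSpace

variable {E : Type*} [NormedAddCommGroup E] [InnerProductSpace ℝ E]

noncomputable def cst (E : Type*) [NormedAddCommGroup E] [InnerProductSpace ℝ E] : ℝ :=
  ((2 * Real.pi) ^ (finrank ℝ E / 2 : ℝ))⁻¹

lemma cst_nonneg : 0 ≤ cst E := by unfold cst; positivity

noncomputable def den (x : E) : ℝ := cst E * Real.exp (-(1/2) * ‖x‖ ^ 2)

lemma den_nonneg (x : E) : 0 ≤ den x := mul_nonneg cst_nonneg (Real.exp_pos _).le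

lemma den_cont : Continuous (den : E → ℝ) := by unfold den; fun_prop

variable [FiniteDimensional ℝ E] [MeasurableSpace E] [BorelSpace E]
lemma integral_wd (f : E → ℂ) :
    ∫ x, f x ∂((volume : Measure E).withDensity (fun x => ENNReal.ofReal (den x)))
      = ∫ x, (den x : ℂ) * f x := by
  have h := integral_withDensity_eq_integral_smul (μ := (volume : Measure E))
    (f := fun x => (den x).toNNReal) (by have := den_cont (E := E); fun_prop) f
  have h2 : (fun x : E => ENNReal.ofReal (den x)) = fun x => (((den x).toNNReal : NNReal) : ENNReal) := by
    ext x; rfl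
  rw [h2, h]
  congr 1; ext x
  rw [NNReal.smul_def, Real.coe_toNNReal _ (den_nonneg x)]
  simp

lemma den_integrable : Integrable (den : E → ℝ) := by
  have h := GaussianFourier.integrable_cexp_neg_mul_sq_norm_add (V := E) (b := (1/2 : ℂ)) (by norm_num) 0 0
  have h2 := (h.norm).const_mul (cst E)
  refine h2.congr (ae_of_all _ fun x => ?_)
  simp only [zero_mul, add_zero, Complex.norm_exp, den]
  congr 2
  have : (-(1 / 2 : ℂ) * (‖x‖:ℂ) ^ 2) = ((-(1/2) * ‖x‖^2 : ℝ) : ℂ) := by push_cast; ring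
  rw [this, ofReal_re]

lemma std_eq : stdGaussian E = (volume : Measure E).withDensity (fun x => ENNReal.ofReal (den x)) := by
  have : IsFiniteMeasure ((volume : Measure E).withDensity (fun x => ENNReal.ofReal (den x))) :=
    isFiniteMeasure_withDensity_ofReal den_integrable.2
  apply Measure.ext_of_charFun
  ext t
  rw [charFun_stdGaussian, charFun_apply, integral_wd]
  have h := GaussianFourier.integral_cexp_neg_mul_sq_norm_add (V := E) (b := (1/2 : ℂ)) (by norm_num) I t
  have h2 : ∀ x : E, (den x : ℂ) * cexp (⟪x, t⟫ * I)
      = (cst E : ℂ) * cexp (-(1/2) * ‖x‖ ^ 2 + I * ⟪t, x⟫) := by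
    intro x
    rw [den, Complex.exp_add, real_inner_comm]
    push_cast
    ring_nf
  simp_rw [h2]
  rw [integral_const_mul, h, ← mul_assoc]
  have h3 : (cst E : ℂ) * ((Real.pi : ℂ) / (1/2)) ^ (finrank ℝ E / 2 : ℂ) = 1 := by
    have : ((Real.pi : ℂ) / (1/2)) ^ (finrank ℝ E / 2 : ℂ)
        = (((2 * Real.pi) ^ (finrank ℝ E / 2 : ℝ) : ℝ) : ℂ) := by
      rw [Complex.ofReal_cpow (by positivity)]
      push_cast
      congr 1
      ring
    rw [this, cst, ← ofReal_mul, inv_mul_cancel₀ (by positivity), ofReal_one]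
  rw [h3, one_mul]
  congr 1
  rw [I_sq]; ring

lemma integral_std (f : E → ℂ) : ∫ x, f x ∂(stdGaussian E) = ∫ x, (den x : ℂ) * f x := by
  rw [std_eq, integral_wd]

/-- polar factorisation -/
lemma polar [Nontrivial E] (h : E → ℂ) (hh : ∀ r : ℝ, 0 < r → ∀ x, h (r • x) = h x) (g : ℝ → ℂ) :
    ∫ x : E, h x * g ‖x‖ = (∫ y, h y.1 ∂((volume : Measure E).toSphere)) *
      ∫ r, g r.1 ∂(Measure.volumeIoiPow (finrank ℝ E - 1)) := by
  calc
    ∫ x : E, h x * g ‖x‖ = ∫ x : ({(0)}ᶜ : Set E), h x.1 * g ‖x.1‖ ∂((volume : Measure E).comap Subtype.val) := by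
      rw [integral_subtype_comap (measurableSet_singleton _).compl (fun x ↦ h x * g (‖x‖)),
        restrict_compl_singleton]
    _ = ∫ x, h x.1.1 * g x.2.1 ∂(volume : Measure E).toSphere.prod (.volumeIoiPow (finrank ℝ E - 1)) := by
      rw [← (volume : Measure E).measurePreserving_homeomorphUnitSphereProd.integral_comp
        (Homeomorph.measurableEmbedding _)]
      congr 1; ext x
      simp only [homeomorphUnitSphereProd_apply_fst_coe, homeomorphUnitSphereProd_apply_snd_coe]
      rw [hh]
      exact inv_pos.2 (norm_pos_iff.2 x.2)
    _ = _ := integral_prod_mul (fun y : Metric.sphere (0:E) 1 => h y.1) (fun r : Set.Ioi (0:ℝ) => g r.1)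

lemma radial_indep [Nontrivial E] (h : E → ℂ) (hh : ∀ r : ℝ, 0 < r → ∀ x, h (r • x) = h x) (g : ℝ → ℂ) :
    ∫ x : E, h x * g ‖x‖ ∂(stdGaussian E)
      = (∫ x, h x ∂(stdGaussian E)) * ∫ x, g ‖x‖ ∂(stdGaussian E) := by
  have key : ∀ (h : E → ℂ) (hh : ∀ r : ℝ, 0 < r → ∀ x, h (r • x) = h x) (g : ℝ → ℂ),
      ∫ x : E, h x * g ‖x‖ ∂(stdGaussian E) = (∫ y, h y.1 ∂((volume : Measure E).toSphere)) *
      ∫ r : Set.Ioi (0:ℝ), ((cst E * Real.exp (-(1/2) * r.1 ^ 2) : ℝ) : ℂ) * g r.1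
        ∂(Measure.volumeIoiPow (finrank ℝ E - 1)) := by
    intro h hh g
    rw [integral_std, ← polar h hh (fun r => ((cst E * Real.exp (-(1/2) * r ^ 2) : ℝ) : ℂ) * g r)]
    congr 1; ext x
    rw [den]; ring
  have h1 := key h hh g
  have h2 := key h hh (fun _ => 1)
  have h3 := key (fun _ => 1) (by simp) g
  have h4 := key (fun _ => 1) (by simp) (fun _ => 1)
  simp only [mul_one, one_mul, integral_const, probReal_univ, one_smul] at h1 h2 h3 h4
  rw [h1, h2, h3]
  linear_combination (∫ y, h y.1 ∂((volume : Measure E).toSphere)) * (∫ r : Set.Ioi (0:ℝ), ((cst E * Real.exp (-(1/2) * r.1 ^ 2) : ℝ) : ℂ) * g r.1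
        ∂(Measure.volumeIoiPow (finrank ℝ E - 1))) * h4

noncomputable def phi (m : ℕ) (s : ℝ) : ℂ :=
  Complex.Gamma ((m / 2 : ℝ) + s * I) / Complex.Gamma ((m / 2 : ℝ)) * cexp ((s * Real.log 2 : ℝ) * I)

lemma mellin_gauss (w : ℂ) (hw : 0 < w.re) :
    mellin (fun y : ℝ => ((Real.exp (-(1/2) * y ^ 2) : ℝ) : ℂ)) w
      = (1/2 : ℂ) * (cexp (w / 2 * Real.log 2) * Complex.Gamma (w / 2)) := by
  have h1 := mellin_comp_rpow (fun y : ℝ => ((Real.exp (-((1/2) * y)) : ℝ) : ℂ)) w 2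
  have h2 := mellin_comp_mul_left (fun y : ℝ => ((Real.exp (-y) : ℝ) : ℂ)) (w / (2:ℝ)) (a := 1/2) (by norm_num)
  rw [h2, ← GammaIntegral_eq_mellin, ← Gamma_eq_integral] at h1
  · convert h1 using 1
    · congr 1; ext y
      norm_cast
      congr 2
      ring
    · simp only [smul_eq_mul, real_smul]
      have : ((1/2 : ℝ) : ℂ) ^ (-(w / (2:ℝ))) = cexp (w / 2 * Real.log 2) := by
        rw [cpow_def_of_ne_zero (by norm_num), ← ofReal_log (by norm_num), one_div, Real.log_inv]
        congr 1; push_cast; ring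
      rw [this]
      norm_num
  · simp; linarith

lemma integral_radial_std [Nontrivial E] : ∃ C : ℂ, ∀ g : ℝ → ℂ,
    ∫ x : E, g ‖x‖ ∂(stdGaussian E) = C *
      ∫ y in Set.Ioi (0 : ℝ), (y:ℂ) ^ (finrank ℝ E - 1) * (((Real.exp (-(1/2) * y ^ 2) : ℝ) : ℂ) * g y) := by
  refine ⟨(finrank ℝ E : ℂ) * (volume.real (Metric.ball (0 : E) 1) : ℂ) * cst E, fun g => ?_⟩
  rw [integral_std]
  have h := integral_fun_norm_addHaar (volume : Measure E)
    (fun y => ((cst E * Real.exp (-(1/2) * y ^ 2) : ℝ) : ℂ) * g y)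
  simp only [den]
  rw [h, ← integral_const_mul]
  simp only [nsmul_eq_mul, real_smul]
  rw [← integral_const_mul, ← integral_const_mul]
  congr 1; ext y
  push_cast; ring

lemma phi_eq [Nontrivial E] (s : ℝ) :
    ∫ x : E, cexp ((s * Real.log (‖x‖ ^ 2) : ℝ) * I) ∂(stdGaussian E) = phi (finrank ℝ E) s := by
  obtain ⟨C, hC⟩ := integral_radial_std (E := E)
  have hm : 0 < finrank ℝ E := finrank_pos
  have key : ∀ s : ℝ, ∫ y in Set.Ioi (0 : ℝ), (y:ℂ) ^ (finrank ℝ E - 1) *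
      (((Real.exp (-(1/2) * y ^ 2) : ℝ) : ℂ) * cexp ((s * Real.log (y ^ 2) : ℝ) * I))
      = (1/2 : ℂ) * (cexp (((finrank ℝ E / 2 : ℝ) + s * I) * Real.log 2)
          * Complex.Gamma ((finrank ℝ E / 2 : ℝ) + s * I)) := by
    intro s
    have h := mellin_gauss ((finrank ℝ E : ℝ) + 2 * s * I) (by simpa using hm)
    have e : (((finrank ℝ E : ℝ) : ℂ) + 2 * s * I) / 2 = (finrank ℝ E / 2 : ℝ) + s * I := by
      push_cast; ring
    rw [e] at h
    rw [← h, mellin]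
    refine setIntegral_congr_fun measurableSet_Ioi fun y hy => ?_
    have hy : (0:ℝ) < y := hy
    simp only [smul_eq_mul]
    have : (y:ℂ) ^ (((finrank ℝ E : ℝ) : ℂ) + 2 * s * I - 1) =
        (y:ℂ) ^ (finrank ℝ E - 1) * cexp ((s * Real.log (y ^ 2) : ℝ) * I) := by
      rw [show ((finrank ℝ E : ℝ) : ℂ) + 2 * s * I - 1 = ((finrank ℝ E - 1 : ℕ) : ℂ) + 2 * s * I by
        rw [Nat.cast_sub hm]; push_cast; ring, cpow_add _ _ (by exact_mod_cast hy.ne'), cpow_natCast,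
        cpow_def_of_ne_zero (by exact_mod_cast hy.ne'), ← ofReal_log hy.le, Real.log_pow]
      congr 2; push_cast; ring
    rw [this]; ring
  have h1 := hC (fun y => cexp ((s * Real.log (y ^ 2) : ℝ) * I))
  have h0 := hC (fun y => cexp (((0:ℝ) * Real.log (y ^ 2) : ℝ) * I))
  rw [key] at h1 h0
  simp only [zero_mul, ofReal_zero, Complex.exp_zero, integral_const, probReal_univ, one_smul, add_zero] at h0
  rw [h1, phi, add_mul, Complex.exp_add]
  have hG : Complex.Gamma ((finrank ℝ E / 2 : ℝ)) ≠ 0 := by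
    apply Complex.Gamma_ne_zero_of_re_pos; simpa using hm
  rw [div_mul_eq_mul_div (Complex.Gamma _) (Complex.Gamma _), eq_div_iff hG]
  have : cexp (s * I * (Real.log 2 : ℝ)) = cexp ((s * Real.log 2 : ℝ) * I) := by
    congr 1; push_cast; ring
  rw [this]
  linear_combination (-Complex.Gamma ((finrank ℝ E / 2 : ℝ) + s * I) * cexp ((s * Real.log 2 : ℝ) * I)) * h0

end dens
end JY

namespace JY
section col
open Complex Module
open scoped RealInnerProductSpace

variable {E : Type*} [NormedAddCommGroup E] [InnerProductSpace ℝ E] [FiniteDimensional ℝ E]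
  [MeasurableSpace E] [BorelSpace E]

lemma map_proj (V : Submodule ℝ E) :
    (stdGaussian E).map (fun x => V.orthogonalProjectionOnto x) = stdGaussian V := by
  have : IsProbabilityMeasure ((stdGaussian E).map (fun x => V.orthogonalProjectionOnto x)) :=
    Measure.isProbabilityMeasure_map (by fun_prop)
  apply Measure.ext_of_charFun
  ext t
  rw [charFun_stdGaussian, charFun_apply, integral_map (by fun_prop) (by fun_prop)]
  have h := charFun_stdGaussian (E := E) (t : E)
  rw [charFun_apply] at h
  simp_rw [Submodule.inner_orthogonalProjectionOnto_eq_of_mem_right]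
  rw [h]; simp

lemma indep_proj {ι : Type*} [Fintype ι] (V : ι → Submodule ℝ E) (hV : Pairwise fun i j => V i ⟂ V j) :
    iIndepFun (fun i (x : E) => (V i).orthogonalProjectionOnto x) (stdGaussian E) := by
  classical
  rw [iIndepFun_iff_charFun_pi (fun i => by fun_prop)]
  intro t
  simp_rw [map_proj, charFun_stdGaussian]
  rw [charFun_apply, integral_map (by fun_prop) (by fun_prop)]
  have h := charFun_stdGaussian (E := E) (∑ i, ((t i : V i) : E))
  rw [charFun_apply] at h
  have e : ∀ x : E, ⟪WithLp.toLp 2 (fun i => (V i).orthogonalProjectionOnto x), t⟫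
      = ⟪x, ∑ i, ((t i : V i) : E)⟫ := by
    intro x
    rw [PiLp.inner_apply, inner_sum]
    refine Finset.sum_congr rfl fun i _ => ?_
    simp only [Submodule.inner_orthogonalProjectionOnto_eq_of_mem_right]
  simp_rw [e]
  rw [h, ← Complex.exp_sum]
  congr 1
  have hf : OrthogonalFamily ℝ (fun i => V i) (fun i => (V i).subtypeₗᵢ) := by
    intro i j hij v w
    exact (hV hij).inner_eq v.2 w.2
  have h2 := hf.norm_sum (fun i => t i) Finset.univ
  change ‖∑ i, ((t i : V i) : E)‖ ^ 2 = _ at h2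
  rw [← ofReal_pow, h2]
  push_cast
  rw [neg_div, Finset.sum_div, ← Finset.sum_neg_distrib]
  simp [neg_div]

lemma ae_ne_zero [Nontrivial E] : ∀ᵐ x ∂(stdGaussian E), x ≠ 0 := by
  have : stdGaussian E ≪ volume := by
    rw [std_eq]; exact withDensity_absolutelyContinuous _ _
  apply this.ae_le
  exact Measure.ae_ne volume (0 : E)

lemma ae_proj_ne (V : Submodule ℝ E) (hV : 1 ≤ finrank ℝ V) :
    ∀ᵐ x ∂(stdGaussian E), V.starProjection x ≠ 0 := by
  have : Nontrivial V := finrank_pos_iff.1 hV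
  have h := ae_ne_zero (E := V)
  rw [← map_proj] at h
  replace h := ae_of_ae_map (by fun_prop) h
  filter_upwards [h] with x hx
  rw [Submodule.starProjection_apply]
  exact fun h0 => hx (Subtype.ext h0)

lemma col {ι : Type*} [Fintype ι] (U : Submodule ℝ E) (V : ι → Submodule ℝ E)
    (hV : Pairwise fun i j => V i ⟂ V j) (hU : ∀ i, V i ≤ U) (hU1 : 1 ≤ finrank ℝ U)
    (hV1 : ∀ i, 1 ≤ finrank ℝ (V i)) (s : ι → ℝ) :
    (∫ x, cexp ((∑ i, s i * Real.log (‖(V i).starProjection x‖ ^ 2 / ‖U.starProjection x‖ ^ 2) : ℝ) * I)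
      ∂(stdGaussian E)) * phi (finrank ℝ U) (∑ i, s i)
    = ∏ i, phi (finrank ℝ (V i)) (s i) := by
  have : Nontrivial U := finrank_pos_iff.1 hU1
  have hVn : ∀ i, Nontrivial (V i) := fun i => finrank_pos_iff.1 (hV1 i)
  -- push to U
  let h : U → ℂ := fun y => cexp ((∑ i, s i * Real.log (‖(V i).starProjection (y:E)‖ ^ 2 / ‖y‖ ^ 2) : ℝ) * I)
  have hm : Measurable h := by fun_prop
  have h1 : ∫ x, cexp ((∑ i, s i * Real.log (‖(V i).starProjection x‖ ^ 2 / ‖U.starProjection x‖ ^ 2) : ℝ) * I)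
      ∂(stdGaussian E) = ∫ y, h y ∂(stdGaussian U) := by
    rw [← map_proj, integral_map (by fun_prop) hm.aestronglyMeasurable]
    congr 1; ext x
    simp only [h]
    have : ∀ i, (V i).starProjection (U.orthogonalProjectionOnto x : E) = (V i).starProjection x := by
      intro i
      rw [← Submodule.starProjection_apply]
      exact DFunLike.congr_fun (Submodule.starProjection_comp_starProjection_of_le (hU i)) x
    simp_rw [this]
    rw [Submodule.starProjection_apply]; simp
  have hh : ∀ r : ℝ, 0 < r → ∀ x, h (r • x) = h x := by
    intro r hr x
    simp only [h]
    congr 5; ext i; congr 2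
    simp only [Submodule.coe_smul, map_smul, norm_smul, mul_pow]
    rw [mul_div_mul_left _ _ (by have : ‖r‖ ≠ 0 := norm_ne_zero_iff.2 hr.ne'
                                 positivity)]
  have h2 := radial_indep h hh (fun y => cexp (((∑ i, s i) * Real.log (y ^ 2) : ℝ) * I))
  rw [phi_eq] at h2
  rw [h1, ← h2]
  have h3 : ∫ (x : U), h x * cexp (((∑ i, s i) * Real.log (‖x‖ ^ 2) : ℝ) * I) ∂stdGaussian U
      = ∫ (x : U), ∏ i, cexp ((s i * Real.log (‖(V i).starProjection (x:E)‖ ^ 2) : ℝ) * I) ∂stdGaussian U := by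
    apply integral_congr_ae
    have hae : ∀ᵐ (y : U) ∂(stdGaussian U), ∀ i, (V i).starProjection (y : E) ≠ 0 := by
      rw [ae_all_iff]; intro i
      rw [← map_proj, ae_map_iff (p := fun y : U => (V i).starProjection (y : E) ≠ 0) (by fun_prop) (((measurableSet_singleton (0:E)).compl).preimage (f := fun y : U => (V i).starProjection (y : E)) (by fun_prop))]
      filter_upwards [ae_proj_ne (V i) (hV1 i)] with x hx
      rw [← Submodule.starProjection_apply]
      have := DFunLike.congr_fun (Submodule.starProjection_comp_starProjection_of_le (hU i)) x
      simp only [ContinuousLinearMap.comp_apply] at this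
      rw [this]; exact hx
    filter_upwards [hae, ae_ne_zero (E := U)] with y hy hy0
    simp only [h]
    rw [← Complex.exp_add, ← Complex.exp_sum, ← add_mul, ← Finset.sum_mul, ← ofReal_add, ← ofReal_sum]
    congr 3
    rw [Finset.sum_mul, ← Finset.sum_add_distrib]
    refine Finset.sum_congr rfl fun i _ => ?_
    rw [Real.log_div (by simpa using hy i) (by simpa using hy0)]
    ring
  rw [h3]
  have h4 : ∫ (x : U), ∏ i, cexp ((s i * Real.log (‖(V i).starProjection (x:E)‖ ^ 2) : ℝ) * I) ∂stdGaussian U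
     = ∫ x, ∏ i, cexp ((s i * Real.log (‖(V i).orthogonalProjectionOnto x‖ ^ 2) : ℝ) * I) ∂stdGaussian E := by
    rw [← map_proj, integral_map (by fun_prop) (Measurable.aestronglyMeasurable (by fun_prop))]
    congr 1; ext x
    have : ∀ i, (V i).starProjection (U.orthogonalProjectionOnto x : E) = (V i).starProjection x := by
      intro i
      rw [← Submodule.starProjection_apply]
      exact DFunLike.congr_fun (Submodule.starProjection_comp_starProjection_of_le (hU i)) x
    simp_rw [this, Submodule.starProjection_apply]; simp
  rw [h4, (indep_proj V hV).integral_fun_prod_comp (f := fun i y => cexp ((s i * Real.log (‖y‖ ^ 2) : ℝ) * I))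
    (fun i => by fun_prop) (fun i => Measurable.aestronglyMeasurable (by fun_prop))]
  refine Finset.prod_congr rfl fun i _ => ?_
  rw [← phi_eq, ← map_proj, integral_map (by fun_prop) (Measurable.aestronglyMeasurable (by fun_prop))]

end col
end JY

namespace JY
section ind
open Complex Module
open scoped RealInnerProductSpace

section alg
variable {E : Type*} [NormedAddCommGroup E] [InnerProductSpace ℝ E] [FiniteDimensional ℝ E]

noncomputable def GG {p : ℕ} (V : Submodule ℝ E) (c : Fin p → E) : ℝ :=
  (Matrix.of fun a b : Fin p => ⟪V.starProjection (c a), V.starProjection (c b)⟫).det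

lemma GG_nonneg {p : ℕ} (V : Submodule ℝ E) (c : Fin p → E) : 0 ≤ GG V c :=
  (Matrix.posSemidef_gram ℝ (fun a => V.starProjection (c a))).det_nonneg

lemma GG_cont {p : ℕ} (V : Submodule ℝ E) : Continuous (fun c : Fin p → E => GG V c) := by
  unfold GG
  apply Continuous.matrix_det
  apply continuous_matrix
  intro a b
  simp only [Matrix.of_apply]
  fun_prop

noncomputable def cut (V : Submodule ℝ E) (x : E) : Submodule ℝ E := V ⊓ (ℝ ∙ x)ᗮ

lemma mem_cut (V : Submodule ℝ E) (x v : E) : v ∈ cut V x ↔ v ∈ V ∧ ⟪x, v⟫ = 0 := by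
  rw [cut, Submodule.mem_inf, Submodule.mem_orthogonal_singleton_iff_inner_right]

lemma inner_proj (V : Submodule ℝ E) (x v : E) (hv : v ∈ V) : ⟪V.starProjection x, v⟫ = ⟪x, v⟫ := by
  have := V.starProjection_inner_eq_zero x v hv
  rw [inner_sub_left] at this; linarith

lemma finrank_cut (V : Submodule ℝ E) (x : E) (hx : V.starProjection x ≠ 0) :
    finrank ℝ (cut V x) + 1 = finrank ℝ V := by
  have h := Submodule.finrank_add_inf_finrank_orthogonal (K₁ := ℝ ∙ V.starProjection x) (K₂ := V)
    (by rw [Submodule.span_singleton_le_iff_mem]; exact V.starProjection_apply_mem x)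
  rw [finrank_span_singleton hx] at h
  have e : (ℝ ∙ V.starProjection x)ᗮ ⊓ V = cut V x := by
    ext v
    rw [mem_cut, Submodule.mem_inf, Submodule.mem_orthogonal_singleton_iff_inner_right]
    constructor
    · rintro ⟨h1, h2⟩; exact ⟨h2, by rw [← inner_proj V x v h2, h1]⟩
    · rintro ⟨h1, h2⟩; exact ⟨by rw [inner_proj V x v h1, h2], h1⟩
  rw [e] at h; omega

lemma proj_cut (V : Submodule ℝ E) (x : E) (hx : V.starProjection x ≠ 0) (z : E) :
    (cut V x).starProjection z = V.starProjection z -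
      (⟪V.starProjection x, V.starProjection z⟫ / ‖V.starProjection x‖ ^ 2) • V.starProjection x := by
  have hn : ‖V.starProjection x‖ ^ 2 ≠ 0 := by simpa using hx
  apply Submodule.eq_starProjection_of_mem_of_inner_eq_zero
  · rw [mem_cut]
    refine ⟨V.sub_mem (V.starProjection_apply_mem z) (V.smul_mem _ (V.starProjection_apply_mem x)), ?_⟩
    rw [← inner_proj V x _ (V.sub_mem (V.starProjection_apply_mem z) (V.smul_mem _ (V.starProjection_apply_mem x))),
      inner_sub_right, inner_smul_right, real_inner_self_eq_norm_sq]
    field_simp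
    ring
  · intro w hw
    rw [mem_cut] at hw
    rw [inner_sub_left, inner_sub_left, inner_smul_left, inner_proj V z w hw.1, inner_proj V x w hw.1, hw.2]
    simp

lemma GG_cons {p : ℕ} (V : Submodule ℝ E) (x : E) (c : Fin p → E) (hx : V.starProjection x ≠ 0) :
    GG V (Fin.cons x c : Fin (p+1) → E) = ‖V.starProjection x‖ ^ 2 * GG (cut V x) c := by
  have hn : ‖V.starProjection x‖ ^ 2 ≠ 0 := by simpa using hx
  set y := V.starProjection x with hy
  let d : Fin (p+1) → E := fun a => V.starProjection ((Fin.cons x c : Fin (p+1) → E) a)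
  let co : Fin (p+1) → ℝ := Fin.cons 0 (fun a => ⟪y, V.starProjection (c a)⟫ / ‖y‖ ^ 2)
  let B : Matrix (Fin (p+1)) (Fin (p+1)) ℝ := Matrix.of fun a b => ⟪d a, d b⟫ - co a * ⟪d 0, d b⟫
  have h1 : GG V (Fin.cons x c : Fin (p+1) → E) = B.det := by
    unfold GG
    apply Matrix.det_eq_of_forall_row_eq_smul_add_const co 0
    · simp [co]
    · intro i j
      simp [B, co, d]
  rw [h1, Matrix.det_succ_column_zero, Fin.sum_univ_succ]
  have h2 : ∀ a : Fin p, B a.succ 0 = 0 := by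
    intro a
    simp only [B, co, d, Matrix.of_apply, Fin.cons_zero, Fin.cons_succ, ← hy, real_inner_self_eq_norm_sq]
    rw [real_inner_comm]; field_simp; ring
  simp only [h2, mul_zero, zero_mul, Finset.sum_const_zero, add_zero]
  have h3 : B 0 0 = ‖y‖ ^ 2 := by
    simp [B, co, d, ← hy]
  rw [h3]
  simp only [Fin.val_zero, pow_zero, one_mul]
  congr 1
  unfold GG
  congr 1
  ext a b
  simp only [Matrix.submatrix_apply, Fin.succAbove_zero, B, co, d, Matrix.of_apply, Fin.cons_zero, Fin.cons_succ]
  rw [proj_cut V x hx, proj_cut V x hx, ← hy]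
  simp only [inner_sub_left, inner_sub_right, inner_smul_left, inner_smul_right, real_inner_self_eq_norm_sq,
    conj_trivial]
  rw [real_inner_comm y (V.starProjection (c a))]
  field_simp
  ring

end alg

variable {E : Type*} [NormedAddCommGroup E] [InnerProductSpace ℝ E] [FiniteDimensional ℝ E]
  [MeasurableSpace E] [BorelSpace E]

noncomputable abbrev gp (E : Type*) [NormedAddCommGroup E] [InnerProductSpace ℝ E] [FiniteDimensional ℝ E]
  [MeasurableSpace E] [BorelSpace E] (p : ℕ) : Measure (Fin p → E) :=
  Measure.pi (fun _ : Fin p => stdGaussian E)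

lemma mp_cons (p : ℕ) : MeasurePreserving (fun q : E × (Fin p → E) => (Fin.cons q.1 q.2 : Fin (p+1) → E))
    ((stdGaussian E).prod (gp E p)) (gp E (p+1)) := by
  have h := (measurePreserving_piFinSuccAbove (fun _ : Fin (p+1) => stdGaussian E) 0).symm
  convert h using 1
  ext q
  simp [MeasurableEquiv.piFinSuccAbove, Fin.insertNthEquiv]

lemma ae_GG (p : ℕ) : ∀ (V : Submodule ℝ E), p ≤ finrank ℝ V → ∀ᵐ c ∂(gp E p), GG V c ≠ 0 := by
  induction p with
  | zero => intro V _; exact ae_of_all _ fun c => by simp [GG]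
  | succ p ih =>
    intro V hV
    have hms : MeasurableSet {c : Fin (p+1) → E | GG V c ≠ 0} :=
      (isClosed_singleton.preimage (GG_cont V)).measurableSet.compl
    rw [← (mp_cons p).map_eq, ae_map_iff (mp_cons p).measurable.aemeasurable hms]
    rw [Measure.ae_prod_iff_ae_ae (p := fun q : E × (Fin p → E) => GG V (Fin.cons q.1 q.2 : Fin (p+1) → E) ≠ 0) ((mp_cons (E := E) p).measurable hms)]
    filter_upwards [ae_proj_ne V (by omega)] with x hx
    have := finrank_cut V x hx
    filter_upwards [ih (cut V x) (by omega)] with c hc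
    rw [GG_cons V x c hx]
    have hn : ‖V.starProjection x‖ ^ 2 ≠ 0 := by simpa using hx
    exact mul_ne_zero hn hc

lemma main_int {ι : Type*} [Fintype ι] (s : ι → ℝ) (p : ℕ) : ∀ (U : Submodule ℝ E) (V : ι → Submodule ℝ E)
    (hV : Pairwise fun i j => V i ⟂ V j) (hU : ∀ i, V i ≤ U) (hU1 : p ≤ finrank ℝ U)
    (hV1 : ∀ i, p ≤ finrank ℝ (V i)),
    (∫ c, cexp ((∑ i, s i * Real.log (GG (V i) c / GG U c) : ℝ) * I) ∂(gp E p))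
      * ∏ j ∈ Finset.range p, phi (finrank ℝ U - j) (∑ i, s i)
    = ∏ i, ∏ j ∈ Finset.range p, phi (finrank ℝ (V i) - j) (s i) := by
  induction p with
  | zero => intro U V _ _ _ _; simp [GG]
  | succ p ih =>
    intro U V hV hU hU1 hV1
    have hmeas : Measurable fun c : Fin (p+1) → E => cexp ((∑ i, s i * Real.log (GG (V i) c / GG U c) : ℝ) * I) := by
      have h1 := (GG_cont (p := p+1) U).measurable
      have h2 := fun i => (GG_cont (p := p+1) (V i)).measurable
      exact Complex.measurable_exp.comp ((Complex.measurable_ofReal.comp (Finset.measurable_fun_sum _ fun i _ =>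
        ((Real.measurable_log.comp ((h2 i).div h1)).const_mul (s i)))).mul_const I)
    have hint : Integrable (fun c : Fin (p+1) → E => cexp ((∑ i, s i * Real.log (GG (V i) c / GG U c) : ℝ) * I))
        (gp E (p+1)) := by
      refine Integrable.of_bound hmeas.aestronglyMeasurable 1 (ae_of_all _ fun c => ?_)
      rw [Complex.norm_exp_ofReal_mul_I]
    have h1 : ∫ c, cexp ((∑ i, s i * Real.log (GG (V i) c / GG U c) : ℝ) * I) ∂(gp E (p+1))
        = ∫ x, ∫ c', cexp ((∑ i, s i * Real.log (GG (V i) (Fin.cons x c' : Fin (p+1) → E) /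
            GG U (Fin.cons x c' : Fin (p+1) → E)) : ℝ) * I) ∂(gp E p) ∂(stdGaussian E) := by
      rw [← (mp_cons p).map_eq, integral_map (mp_cons p).measurable.aemeasurable hmeas.aestronglyMeasurable]
      rw [integral_prod]
      rw [← (mp_cons p).map_eq] at hint
      exact hint.comp_measurable (mp_cons p).measurable
    have hae : ∀ᵐ x ∂(stdGaussian E), U.starProjection x ≠ 0 ∧ ∀ i, (V i).starProjection x ≠ 0 := by
      rw [eventually_and, ae_all_iff]
      exact ⟨ae_proj_ne U (by omega), fun i => ae_proj_ne (V i) (by have := hV1 i; omega)⟩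
    have hcol := col U V hV hU (by omega) (fun i => by have := hV1 i; omega) s
    have hstep : (∫ x, ∫ c', cexp ((∑ i, s i * Real.log (GG (V i) (Fin.cons x c' : Fin (p+1) → E) /
            GG U (Fin.cons x c' : Fin (p+1) → E)) : ℝ) * I) ∂(gp E p) ∂(stdGaussian E))
          * ∏ j ∈ Finset.range p, phi (finrank ℝ U - 1 - j) (∑ i, s i)
        = (∫ x, cexp ((∑ i, s i * Real.log (‖(V i).starProjection x‖ ^ 2 / ‖U.starProjection x‖ ^ 2) : ℝ) * I)
            ∂(stdGaussian E)) * ∏ i, ∏ j ∈ Finset.range p, phi (finrank ℝ (V i) - 1 - j) (s i) := by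
      rw [← integral_mul_const, ← integral_mul_const]
      apply integral_congr_ae
      filter_upwards [hae] with x hx
      have fU := finrank_cut U x hx.1
      have fV := fun i => finrank_cut (V i) x (hx.2 i)
      have h := ih (cut U x) (fun i => cut (V i) x)
        (fun i j hij => (hV hij).mono inf_le_left inf_le_left) (fun i => inf_le_inf_right _ (hU i))
        (by omega) (fun i => by have := fV i; have := hV1 i; omega)
      have e1 : finrank ℝ U - 1 = finrank ℝ (cut U x) := by omega
      have e2 : ∀ i, finrank ℝ (V i) - 1 = finrank ℝ (cut (V i) x) := fun i => by have := fV i; omega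
      simp only [e1, e2]
      rw [← h, ← mul_assoc]
      congr 1
      rw [← integral_const_mul]
      apply integral_congr_ae
      have hg : ∀ᵐ c ∂(gp E p), ∀ i, GG (cut (V i) x) c ≠ 0 := by
        rw [ae_all_iff]
        exact fun i => ae_GG p _ (by have := fV i; have := hV1 i; omega)
      filter_upwards [hg, ae_GG p (cut U x) (by omega)] with c hc hcU
      rw [← Complex.exp_add, ← add_mul, ← ofReal_add, ← Finset.sum_add_distrib]
      congr 3
      refine Finset.sum_congr rfl fun i _ => ?_
      rw [GG_cons U x c hx.1, GG_cons (V i) x c (hx.2 i), ← mul_add]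
      have n1 : ‖U.starProjection x‖ ^ 2 ≠ 0 := by simpa using hx.1
      have n2 : ‖(V i).starProjection x‖ ^ 2 ≠ 0 := by simpa using hx.2 i
      rw [mul_div_mul_comm, Real.log_mul (div_ne_zero n2 n1) (div_ne_zero (hc i) hcU)]
    rw [h1, Finset.prod_range_succ']
    simp only [Finset.prod_range_succ', Finset.prod_mul_distrib, Nat.sub_zero]
    rw [← hcol, ← mul_assoc]
    have q : ∀ (a : ℕ) (s : ℝ), ∏ j ∈ Finset.range p, phi (a - (j + 1)) s = ∏ j ∈ Finset.range p, phi (a - 1 - j) s :=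
      fun a s => Finset.prod_congr rfl fun j _ => by rw [Nat.sub_sub, add_comm 1 j]
    simp only [q]
    rw [hstep]
    ring

end ind
end JY

namespace JY
section app
open Complex Module
open scoped RealInnerProductSpace

noncomputable def ZZ (κ : Type*) [Fintype κ] : Submodule ℝ (EuclideanSpace ℝ κ) :=
  (ℝ ∙ (WithLp.toLp 2 (fun _ => 1) : EuclideanSpace ℝ κ))ᗮ

lemma mem_ZZ {κ : Type*} [Fintype κ] (x : EuclideanSpace ℝ κ) : x ∈ ZZ κ ↔ ∑ q, x q = 0 := by
  rw [ZZ, Submodule.mem_orthogonal_singleton_iff_inner_right, PiLp.inner_apply]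
  simp

lemma finrank_ZZ (κ : Type*) [Fintype κ] [Nonempty κ] : finrank ℝ (ZZ κ) + 1 = Fintype.card κ := by
  have h := Submodule.finrank_add_finrank_orthogonal (ℝ ∙ (WithLp.toLp 2 (fun _ => 1) : EuclideanSpace ℝ κ))
  rw [finrank_span_singleton, finrank_euclideanSpace] at h
  · rw [ZZ, ← h, add_comm]
  · intro h0
    have := congrArg (fun x : EuclideanSpace ℝ κ => x (Classical.arbitrary κ)) h0
    simp at this

lemma inner_eq {κ : Type*} [Fintype κ] (x y : EuclideanSpace ℝ κ) : ⟪x, y⟫ = ∑ q, x q * y q := by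
  rw [PiLp.inner_apply]; simp [mul_comm]

lemma proj_ZZ {κ : Type*} [Fintype κ] [Nonempty κ] (x : EuclideanSpace ℝ κ) :
    (ZZ κ).starProjection x = WithLp.toLp 2 (fun q => x q - (∑ q, x q) / Fintype.card κ) := by
  apply Submodule.eq_starProjection_of_mem_of_inner_eq_zero
  · rw [mem_ZZ]
    simp only [Finset.sum_sub_distrib, Finset.sum_const, Finset.card_univ, nsmul_eq_mul]
    field_simp; ring
  · intro w hw
    rw [mem_ZZ] at hw
    rw [inner_eq]
    simp [← Finset.mul_sum, hw]

variable {k : ℕ} (nn : Fin k → ℕ)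

abbrev II := (i : Fin k) × Fin (nn i)
abbrev EE := EuclideanSpace ℝ (II nn)

noncomputable def JJ (i : Fin k) : EuclideanSpace ℝ (Fin (nn i)) →ₗ[ℝ] EE nn :=
  (WithLp.linearEquiv 2 ℝ (II nn → ℝ)).symm.toLinearMap ∘ₗ
    Function.ExtendByZero.linearMap ℝ (fun j : Fin (nn i) => (⟨i, j⟩ : II nn)) ∘ₗ
    (WithLp.linearEquiv 2 ℝ (Fin (nn i) → ℝ)).toLinearMap

lemma JJ_same (i : Fin k) (u : EuclideanSpace ℝ (Fin (nn i))) (j : Fin (nn i)) : JJ nn i u ⟨i, j⟩ = u j :=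
  Function.Injective.extend_apply (f := fun j : Fin (nn i) => (⟨i, j⟩ : II nn)) (fun a b h => by simpa using h) u.ofLp (0 : II nn → ℝ) j

lemma JJ_diff (i i' : Fin k) (h : i' ≠ i) (u : EuclideanSpace ℝ (Fin (nn i))) (j : Fin (nn i')) :
    JJ nn i u ⟨i', j⟩ = 0 := by
  refine Function.extend_apply' (f := fun j : Fin (nn i) => (⟨i, j⟩ : II nn)) u.ofLp (0 : II nn → ℝ) _ ?_
  rintro ⟨a, ha⟩
  exact h (congrArg Sigma.fst ha).symm

lemma JJ_inj (i : Fin k) : Function.Injective (JJ nn i) := by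
  intro u v h
  ext j
  rw [← JJ_same nn i u j, h, JJ_same]

lemma sum_JJ (i : Fin k) (u : EuclideanSpace ℝ (Fin (nn i))) (z : II nn → ℝ) :
    ∑ q, z q * JJ nn i u q = ∑ j, z ⟨i, j⟩ * u j := by
  rw [Fintype.sum_sigma, Finset.sum_eq_single i]
  · simp_rw [JJ_same]
  · intro b _ hb
    exact Finset.sum_eq_zero fun j _ => by rw [JJ_diff nn i b hb, mul_zero]
  · simp

noncomputable def VV (i : Fin k) : Submodule ℝ (EE nn) := (ZZ (Fin (nn i))).map (JJ nn i)

lemma finrank_VV (i : Fin k) (h : 0 < nn i) : finrank ℝ (VV nn i) + 1 = nn i := by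
  have : Nonempty (Fin (nn i)) := ⟨⟨0, h⟩⟩
  have h1 := finrank_ZZ (Fin (nn i))
  rw [Fintype.card_fin] at h1
  have h2 := LinearEquiv.finrank_eq (Submodule.equivMapOfInjective (JJ nn i) (JJ_inj nn i) (ZZ (Fin (nn i))))
  rw [VV]
  omega

lemma VV_le (i : Fin k) : VV nn i ≤ ZZ (II nn) := by
  rintro _ ⟨u, hu, rfl⟩
  rw [mem_ZZ]
  have := sum_JJ nn i u (fun _ => 1)
  simp only [one_mul] at this
  rw [this]
  exact (mem_ZZ u).1 hu

lemma VV_ortho : Pairwise fun i j => VV nn i ⟂ VV nn j := by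
  intro i j hij
  rw [Submodule.isOrtho_iff_inner_eq]
  rintro _ ⟨u, hu, rfl⟩ _ ⟨v, hv, rfl⟩
  rw [inner_eq, sum_JJ]
  exact Finset.sum_eq_zero fun a _ => by rw [JJ_diff nn i j hij.symm, zero_mul]

lemma proj_VV (i : Fin k) (h : 0 < nn i) (x : EE nn) :
    (VV nn i).starProjection x = JJ nn i (WithLp.toLp 2 (fun j => x ⟨i, j⟩ - (∑ j, x ⟨i, j⟩) / nn i)) := by
  have : Nonempty (Fin (nn i)) := ⟨⟨0, h⟩⟩
  have hn : (nn i : ℝ) ≠ 0 := by exact_mod_cast h.ne'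
  apply Submodule.eq_starProjection_of_mem_of_inner_eq_zero
  · refine ⟨_, ?_, rfl⟩
    rw [SetLike.mem_coe, mem_ZZ]
    simp only [Finset.sum_sub_distrib, Finset.sum_const, Finset.card_univ, nsmul_eq_mul, Fintype.card_fin]
    field_simp; ring
  · rintro _ ⟨u, hu, rfl⟩
    rw [SetLike.mem_coe, mem_ZZ] at hu
    rw [inner_eq, sum_JJ]
    simp [JJ_same, ← Finset.mul_sum, hu]

/-- columns -/
noncomputable def cols {p : ℕ} (ω : II nn × Fin p → ℝ) : Fin p → EE nn :=
  fun a => WithLp.toLp 2 (fun q => ω (q, a))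

lemma mp_cols (p : ℕ) : MeasurePreserving (cols nn (p := p)) (Measure.pi fun _ => gaussianReal 0 1)
    (gp (EE nn) p) := by
  have h1 := measurePreserving_piCongrLeft (α := fun _ : Fin p × II nn => ℝ)
    (fun _ => gaussianReal 0 1) (Equiv.prodComm (II nn) (Fin p))
  have h2 : MeasurePreserving (MeasurableEquiv.curry (Fin p) (II nn) ℝ)
      (Measure.pi fun _ => gaussianReal 0 1) (Measure.pi fun _ => Measure.pi fun _ => gaussianReal 0 1) := by
    refine ⟨MeasurableEquiv.measurable _, ?_⟩
    have := Measure.infinitePi_map_curry (fun (_ : Fin p) (_ : II nn) => gaussianReal 0 1)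
    simpa only [Measure.infinitePi_eq_pi] using this
  have h3 : MeasurePreserving (fun (a : Fin p → II nn → ℝ) i => (WithLp.toLp 2 (a i) : EE nn))
      (Measure.pi fun _ => Measure.pi fun _ => gaussianReal 0 1) (gp (EE nn) p) := by
    apply measurePreserving_pi
    intro i
    exact ⟨by fun_prop, map_pi_eq_stdGaussian⟩
  have h := (h3.comp h2).comp h1
  convert h using 1
  funext ω
  funext a
  ext q
  simp only [cols, Function.comp_apply]
  exact (Equiv.piCongrLeft_apply_apply (fun _ : Fin p × II nn => ℝ) (Equiv.prodComm (II nn) (Fin p)) ω (q, a)).symm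

end app
end JY

namespace JY
section stat
open Complex Module
open scoped RealInnerProductSpace
variable {k : ℕ} (nn : Fin k → ℕ)

lemma GG_VV {p : ℕ} (i : Fin k) (h : 0 < nn i) (ω : II nn × Fin p → ℝ) :
    (∑ j, Matrix.vecMulVec (fun c => ω (⟨i, j⟩, c) - (∑ j, ω (⟨i, j⟩, c)) / (nn i))
      (fun c => ω (⟨i, j⟩, c) - (∑ j, ω (⟨i, j⟩, c)) / (nn i))).det = GG (VV nn i) (cols nn ω) := by
  rw [GG]
  congr 1
  ext a b
  rw [Matrix.of_apply, proj_VV nn i h, proj_VV nn i h, inner_eq, sum_JJ, Matrix.sum_apply]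
  simp [JJ_same, vecMulVec_apply, cols]

lemma GG_ZZ {p : ℕ} (hk : 0 < k) (h : ∀ i, 0 < nn i) (ω : II nn × Fin p → ℝ)
    (ybar : Fin k → Fin p → ℝ) (gbar : Fin p → ℝ)
    (hy : ∀ i c, ybar i c = (∑ j, ω (⟨i, j⟩, c)) / (nn i))
    (hg : ∀ c, gbar c = (∑ i, (nn i : ℝ) * ybar i c) / (∑ i, (nn i : ℝ))) :
    (∑ i, (nn i : ℝ) • Matrix.vecMulVec (fun c => ybar i c - gbar c)
      (fun c => ybar i c - gbar c) + ∑ i, ∑ j, Matrix.vecMulVec (fun c => ω (⟨i, j⟩, c) - ybar i c)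
      (fun c => ω (⟨i, j⟩, c) - ybar i c)).det = GG (ZZ (II nn)) (cols nn ω) := by
  have hs : ∀ i c, ∑ j, ω (⟨i, j⟩, c) = nn i * ybar i c := by
    intro i c
    have : (nn i : ℝ) ≠ 0 := by exact_mod_cast (h i).ne'
    rw [hy]; field_simp
  have : Nonempty (II nn) := ⟨⟨⟨0, hk⟩, ⟨0, h _⟩⟩⟩
  rw [GG]
  congr 1
  ext a b
  have hG : ∀ c, (∑ q : II nn, ω (q, c)) / (Fintype.card (II nn)) = gbar c := by
    intro c
    rw [hg, Fintype.sum_sigma]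
    simp [hs]
  rw [Matrix.of_apply, proj_ZZ, proj_ZZ, inner_eq]
  simp only [cols, hG]
  rw [Fintype.sum_sigma, Matrix.add_apply, Matrix.sum_apply, Matrix.sum_apply, ← Finset.sum_add_distrib]
  refine Finset.sum_congr rfl fun i _ => ?_
  rw [Matrix.sum_apply]
  simp only [Matrix.smul_apply, vecMulVec_apply, smul_eq_mul]
  have e : ∀ j, (ω (⟨i, j⟩, a) - gbar a) * (ω (⟨i, j⟩, b) - gbar b) =
    (ω (⟨i, j⟩, a) - ybar i a) * (ω (⟨i, j⟩, b) - ybar i b)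
    + ((ybar i a - gbar a) * (ω (⟨i, j⟩, b) - ybar i b) + (ω (⟨i, j⟩, a) - ybar i a) * (ybar i b - gbar b)
     + (ybar i a - gbar a) * (ybar i b - gbar b)) := fun j => by ring
  simp only [e, Finset.sum_add_distrib, ← Finset.mul_sum, ← Finset.sum_mul, Finset.sum_sub_distrib, hs]
  simp
  ring

noncomputable def kst (p : ℕ) : ℝ := (p : ℝ) * (∑ i, (nn i : ℝ)) / 2 * Real.log (∑ i, (nn i : ℝ))
  - ∑ i, (p : ℝ) * (nn i) / 2 * Real.log (nn i)

lemma stat_eq {p : ℕ} (hk : 0 < k) (h : ∀ i, 0 < nn i) (ω : II nn × Fin p → ℝ)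
    (h1 : ∀ i, GG (VV nn i) (cols nn ω) ≠ 0) (h2 : GG (ZZ (II nn)) (cols nn ω) ≠ 0) :
    logIdenticalStat k p nn ω = ∑ i, (nn i : ℝ) / 2 * Real.log (GG (VV nn i) (cols nn ω) / GG (ZZ (II nn)) (cols nn ω))
      + kst nn p := by
  have hn0 : ∀ i, (0 : ℝ) < nn i := fun i => by exact_mod_cast h i
  have hn : (0 : ℝ) < ∑ i, (nn i : ℝ) :=
    Finset.sum_pos (fun i _ => hn0 i) ⟨⟨0, hk⟩, Finset.mem_univ _⟩
  have h1' : ∀ i, 0 < GG (VV nn i) (cols nn ω) := fun i => lt_of_le_of_ne (GG_nonneg _ _) (h1 i).symm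
  have h2' : 0 < GG (ZZ (II nn)) (cols nn ω) := lt_of_le_of_ne (GG_nonneg _ _) h2.symm
  unfold logIdenticalStat
  simp only
  rw [GG_ZZ nn hk h ω _ _ (fun _ _ => rfl) (fun _ => rfl)]
  have e : ∀ i, _ := fun i => GG_VV nn i (h i) ω
  simp only [e]
  have p1 : ∀ i, 0 < GG (VV nn i) (cols nn ω) ^ ((nn i : ℝ) / 2) := fun i => Real.rpow_pos_of_pos (h1' i) _
  have p2 := Real.rpow_pos_of_pos h2' ((∑ i, (nn i : ℝ)) / 2)
  have p3 := Real.rpow_pos_of_pos hn ((p : ℝ) * (∑ i, (nn i : ℝ)) / 2)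
  have p4 : ∀ i, 0 < (nn i : ℝ) ^ ((p : ℝ) * (nn i) / 2) := fun i => Real.rpow_pos_of_pos (hn0 i) _
  have p1' := Finset.prod_pos (s := Finset.univ) fun i _ => p1 i
  have p4' := Finset.prod_pos (s := Finset.univ) fun i _ => p4 i
  rw [Real.log_mul (div_pos p1' p2).ne' (div_pos p3 p4').ne', Real.log_div p1'.ne' p2.ne', Real.log_div p3.ne' p4'.ne',
    Real.log_prod (fun i _ => (p1 i).ne'), Real.log_prod (fun i _ => (p4 i).ne'), Real.log_rpow h2', Real.log_rpow hn, kst]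
  simp only [Real.log_rpow (h1' _), Real.log_rpow (hn0 _), Real.log_div (h1 _) h2, mul_sub, Finset.sum_sub_distrib]
  rw [← Finset.sum_mul, Finset.sum_div]

lemma stat_meas (p : ℕ) : Measurable (logIdenticalStat k p nn) := by
  unfold logIdenticalStat
  apply Real.measurable_log.comp
  have hd : ∀ M : (II nn × Fin p → ℝ) → Matrix (Fin p) (Fin p) ℝ, Continuous M → Measurable fun ω => (M ω).det :=
    fun M hM => (Continuous.matrix_det hM).measurable
  refine Measurable.mul (Measurable.div (Finset.measurable_prod _ fun i _ => ?_) ?_) measurable_const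
  · refine (hd _ ?_).pow_const _
    fun_prop
  · refine (hd _ ?_).pow_const _
    fun_prop

end stat
end JY

namespace JY
section chf
open Complex Module

lemma prod_phi (d p : ℕ) (s : ℝ) :
    ∏ j ∈ Finset.range p, phi (d + p - j) s = GR s d p * cexp ((s * (p * Real.log 2) : ℝ) * I) := by
  rw [← Finset.prod_range_reflect]
  have : ∀ j ∈ Finset.range p, phi (d + p - (p - 1 - j)) s = phi (d + 1 + j) s := by
    intro j hj
    rw [Finset.mem_range] at hj
    congr 1
    omega
  rw [Finset.prod_congr rfl this, GR]
  simp only [phi]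
  rw [Finset.prod_mul_distrib, Finset.prod_const, Finset.card_range, ← Complex.exp_nat_mul]
  congr 2
  · push_cast
    rfl
  · push_cast; ring

variable {k : ℕ} (nn : Fin k → ℕ)

lemma char_stat (p : ℕ) (hk : 0 < k) (h : ∀ i, p + 1 < nn i) (τ : ℝ) :
    (∫ ω, cexp ((τ * logIdenticalStat k p nn ω : ℝ) * I) ∂(Measure.pi fun _ => gaussianReal 0 1)) *
      GR (τ * (∑ i, (nn i : ℝ)) / 2) (∑ i, nn i - 1 - p) p
    = cexp ((τ * kst nn p : ℝ) * I) * ∏ i, GR (τ * nn i / 2) (nn i - 1 - p) p := by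
  have h0 : ∀ i, 0 < nn i := fun i => by have := h i; omega
  have : Nonempty (II nn) := ⟨⟨⟨0, hk⟩, ⟨0, h0 _⟩⟩⟩
  have hN : p + 1 < ∑ i, nn i :=
    (h ⟨0, hk⟩).trans_le (Finset.single_le_sum (f := nn) (fun _ _ => Nat.zero_le _) (Finset.mem_univ _))
  have fU : finrank ℝ (ZZ (II nn)) = (∑ i, nn i - 1 - p) + p := by
    have := finrank_ZZ (II nn)
    simp only [Fintype.card_sigma, Fintype.card_fin] at this
    omega
  have fV : ∀ i, finrank ℝ (VV nn i) = (nn i - 1 - p) + p := by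
    intro i
    have := finrank_VV nn i (h0 i)
    have := h i
    omega
  have key := main_int (fun i => τ * nn i / 2) p (ZZ (II nn)) (VV nn) (VV_ortho nn) (VV_le nn) (by omega)
    (fun i => by rw [fV]; omega)
  rw [fU] at key
  simp only [fV, prod_phi] at key
  rw [Finset.prod_mul_distrib, ← Complex.exp_sum] at key
  have e1 : ∑ i, ((τ * nn i / 2 * (p * Real.log 2) : ℝ) : ℂ) * I = (((∑ i, τ * nn i / 2) * (p * Real.log 2) : ℝ) : ℂ) * I := by
    push_cast
    rw [Finset.sum_mul, Finset.sum_mul]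
  rw [e1, ← mul_assoc] at key
  have key2 := mul_right_cancel₀ (Complex.exp_ne_zero _) key
  have e2 : ∑ i, τ * nn i / 2 = τ * (∑ i, (nn i : ℝ)) / 2 := by rw [← Finset.sum_div, ← Finset.mul_sum]
  rw [e2] at key2
  rw [← key2, ← mul_assoc]
  congr 1
  have mp := mp_cols nn p
  have ae1 : ∀ᵐ ω ∂(Measure.pi fun _ : II nn × Fin p => gaussianReal 0 1),
      (∀ i, GG (VV nn i) (cols nn ω) ≠ 0) ∧ GG (ZZ (II nn)) (cols nn ω) ≠ 0 := by
    refine mp.quasiMeasurePreserving.ae (p := fun c => (∀ i, GG (VV nn i) c ≠ 0) ∧ GG (ZZ (II nn)) c ≠ 0) ?_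
    refine Filter.Eventually.and ?_ (ae_GG p _ (by rw [fU]; omega))
    rw [ae_all_iff]
    intro i
    exact ae_GG p _ (by rw [fV]; omega)
  rw [← mp.map_eq, integral_map mp.aemeasurable, ← integral_const_mul]
  · apply integral_congr_ae
    filter_upwards [ae1] with ω hω
    rw [stat_eq nn hk h0 ω hω.1 hω.2, ← Complex.exp_add]
    congr 1
    rw [← add_mul, ← Complex.ofReal_add]
    congr 2
    rw [mul_add, add_comm, Finset.mul_sum]
    congr 1
    refine Finset.sum_congr rfl fun i _ => by ring
  · apply Measurable.aestronglyMeasurable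
    have hm : ∀ V : Submodule ℝ (EE nn), Measurable fun c : Fin p → EE nn => GG V c := fun V => (GG_cont V).measurable
    refine Complex.measurable_exp.comp ((Complex.measurable_ofReal.comp ?_).mul_const _)
    exact Finset.measurable_sum _ fun i _ => (Real.measurable_log.comp ((hm _).div (hm _))).const_mul _

end chf
end JY

namespace JY
section asy

lemma g_bd {x : ℝ} (hx : 2 ≤ x) : -1 - 2 / x ≤ x * Real.log (1 - 1 / x) ∧ x * Real.log (1 - 1 / x) ≤ -1 := by
  have h0 : 0 < x := by linarith
  have hu : 1 / x ≤ 1 / 2 := one_div_le_one_div_of_le (by norm_num) hx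
  have hp : 0 < 1 - 1 / x := by linarith
  constructor
  · have h1 := Real.one_sub_inv_le_log_of_pos hp
    have h2 : x * (1 - (1 - 1 / x)⁻¹) ≤ x * Real.log (1 - 1 / x) := mul_le_mul_of_nonneg_left h1 h0.le
    refine le_trans ?_ h2
    have hx1 : 0 < x - 1 := by linarith
    have : x * (1 - (1 - 1 / x)⁻¹) = - x / (x - 1) := by
      have : x - 1 ≠ 0 := hx1.ne'
      have e : 1 - 1 / x = (x - 1) / x := by field_simp
      rw [e]
      field_simp
      ring
    rw [this, ← sub_nonneg]
    have : -x / (x - 1) - (-1 - 2 / x) = (x - 2) / (x * (x - 1)) := by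
      field_simp; ring
    rw [this]
    apply div_nonneg <;> nlinarith
  · have h1 := Real.log_le_sub_one_of_pos hp
    have h2 : x * Real.log (1 - 1 / x) ≤ x * (1 - 1 / x - 1) := mul_le_mul_of_nonneg_left h1 h0.le
    have : x * (1 - 1 / x - 1) = -1 := by field_simp; ring
    linarith

/-- n (LL - L) -/
lemma LL_diff {n p : ℝ} (hp : 0 ≤ p) (hn : 2 * p + 4 ≤ n) :
    n * (LL (n - 1 - p) p - (-Real.log (1 - p / n))) =
      n * Real.log (1 - 1 / n) - n / (n - p) * ((n - p) * Real.log (1 - 1 / (n - p))) := by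
  have h1 : 0 < n := by linarith
  have h2 : 0 < n - p := by linarith
  have h3 : 0 < n - 1 - p := by linarith
  have h4 : 0 < n - 1 := by linarith
  have e1 : 1 - p / n = (n - p) / n := by field_simp
  have e2 : 1 - 1 / n = (n - 1) / n := by field_simp
  have e3 : 1 - 1 / (n - p) = (n - 1 - p) / (n - p) := by field_simp; ring
  rw [e1, e2, e3, LL, Real.log_div h2.ne' h1.ne', Real.log_div h4.ne' h1.ne', Real.log_div h3.ne' h2.ne',
    sub_add_cancel]
  field_simp
  ring

lemma LL_diff_bd {n p : ℝ} (hp : 0 ≤ p) (hn : 2 * p + 4 ≤ n) :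
    |n * (LL (n - 1 - p) p - (-Real.log (1 - p / n)))| ≤ 6 := by
  rw [LL_diff hp hn]
  have h2 : 0 < n - p := by linarith
  obtain ⟨a1, a2⟩ := g_bd (x := n) (by linarith)
  obtain ⟨b1, b2⟩ := g_bd (x := n - p) (by linarith)
  set A := n * Real.log (1 - 1 / n)
  set B := (n - p) * Real.log (1 - 1 / (n - p))
  have c1 : 2 / n ≤ 1 := by rw [div_le_one (by linarith)]; linarith
  have c2 : 2 / (n - p) ≤ 1 := by rw [div_le_one (by linarith)]; linarith
  have c3 : n / (n - p) ≤ 2 := by rw [div_le_iff₀ h2]; linarith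
  have c4 : 0 ≤ n / (n - p) := div_nonneg (by linarith) h2.le
  rw [abs_le]
  constructor <;> nlinarith

lemma LL_eq {n p : ℝ} (hp : 0 ≤ p) (hn : p + 1 < n) : LL (n - 1 - p) p = -Real.log (1 - p / (n - 1)) := by
  have h4 : 0 < n - 1 := by linarith
  have h3 : 0 < n - 1 - p := by linarith
  have e1 : 1 - p / (n - 1) = (n - 1 - p) / (n - 1) := by field_simp
  rw [e1, LL, Real.log_div h3.ne' h4.ne', sub_add_cancel]
  ring

lemma phA_eq {n p : ℝ} : phA (n - 1 - p) p = -p * Real.log 2 - p + p * Real.log (n - 1) + (n - p - 3 / 2) * LL (n - 1 - p) p := by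
  rw [phA, LL, sub_add_cancel]
  ring

lemma theta_bd {k : ℕ} (p : ℝ) (N ys : Fin k → ℝ) (hp : 0 ≤ p) (hN : ∀ i, p + 1 < N i) (hN2 : ∀ i, 2 ≤ N i)
    (hy : ∀ i, ys i ∈ Set.Ioc (0 : ℝ) 1) (n : ℝ) (hn : n = ∑ i, N i) (hn2 : 2 * p + 4 ≤ n) :
    |(p * n / 2 * Real.log n - ∑ i, p * N i / 2 * Real.log (N i))
      - (1 / 4) * (-2 * k * p - (∑ i, ys i) + n * (-Real.log (1 - p / n)) * (2 * p - 2 * n + 3)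
        - ∑ i, N i * (-Real.log (1 - p / (N i - 1))) * (2 * p - 2 * N i + 3))
      + (∑ i, N i / 2 * phA (N i - 1 - p) p) - n / 2 * phA (n - 1 - p) p| ≤ 2 * k + 7 := by
  have hn0 : 0 < n := by linarith
  have e1 : ∀ x : ℝ, 2 ≤ x → Real.log (x - 1) = Real.log x + Real.log (1 - 1 / x) := by
    intro x hx
    rw [← Real.log_mul (by linarith)]
    · congr 1; field_simp
    · have : 1 / x ≤ 1 / 2 := one_div_le_one_div_of_le (by norm_num) hx
      linarith
  have e2 : ∑ i, N i / 2 * phA (N i - 1 - p) p = -(p * Real.log 2 + p) * n / 2 + ∑ i, p * N i / 2 * Real.log (N i)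
     + ∑ i, p / 2 * (N i * Real.log (1 - 1 / N i)) +
      1 / 4 * (- ∑ i, N i * (-Real.log (1 - p / (N i - 1))) * (2 * p - 2 * N i + 3)) := by
    rw [hn, Finset.mul_sum, Finset.sum_div, ← Finset.sum_neg_distrib, Finset.mul_sum, ← Finset.sum_add_distrib, ← Finset.sum_add_distrib, ← Finset.sum_add_distrib]
    refine Finset.sum_congr rfl fun i _ => ?_
    rw [phA_eq, LL_eq hp (hN i), e1 _ (hN2 i)]
    ring
  have e3 := LL_diff hp hn2
  have e4 := LL_diff_bd hp hn2
  rw [e2, phA_eq, e1 n (by linarith)]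
  set Lp := LL (n - 1 - p) p
  set L := -Real.log (1 - p / n)
  have T1 : |∑ i, (p / 2 * (N i * Real.log (1 - 1 / N i)) + p / 2 + ys i / 4)| ≤ ∑ i : Fin k, (2 : ℝ) := by
    refine (Finset.abs_sum_le_sum_abs _ _).trans (Finset.sum_le_sum fun i _ => ?_)
    obtain ⟨a1, a2⟩ := g_bd (hN2 i)
    have h0 : 0 < N i := by linarith [hN2 i]
    have a3 : p * (2 / N i) ≤ 2 := by
      rw [← mul_div_assoc, div_le_iff₀ h0]; linarith [hN i]
    have := hy i
    have h3 := this.1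
    have h4 := this.2
    rw [abs_le]
    constructor <;> nlinarith
  simp only [Finset.sum_const, Finset.card_univ, Fintype.card_fin, nsmul_eq_mul, Finset.sum_add_distrib] at T1
  rw [← Finset.sum_div] at T1
  obtain ⟨a1, a2⟩ := g_bd (x := n) (by linarith)
  obtain ⟨b1, b2⟩ := g_bd (x := n - p) (by linarith)
  have hnp : 0 < n - p := by linarith
  set A := n * Real.log (1 - 1 / n) with hA
  set B := (n - p) * Real.log (1 - 1 / (n - p)) with hB
  have T2 : |n * (A - B)| ≤ 4 := by
    have c3 : n / (n - p) ≤ 2 := by rw [div_le_iff₀ hnp]; linarith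
    have c1 : n * (2 / n) = 2 := by field_simp
    have c2 : n * (2 / (n - p)) ≤ 4 := by 
      have : n * (2 / (n - p)) = 2 * (n / (n - p)) := by ring
      linarith
    rw [abs_le]
    constructor <;> nlinarith
  have e5 : (n - p) * (n * (Lp - L)) = (n - p) * A - n * B := by
    rw [e3]; field_simp
  rw [abs_le] at *
  have e6 : p * n / 2 * Real.log n - ∑ i, p * N i / 2 * Real.log (N i) -
              1 / 4 * (-2 * k * p - ∑ i, ys i + n * L * (2 * p - 2 * n + 3) -
                  ∑ i, N i * -Real.log (1 - p / (N i - 1)) * (2 * p - 2 * N i + 3)) +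
            (-(p * Real.log 2 + p) * n / 2 + ∑ i, p * N i / 2 * Real.log (N i) +
                ∑ i, p / 2 * (N i * Real.log (1 - 1 / N i)) +
              1 / 4 * -∑ i, N i * -Real.log (1 - p / (N i - 1)) * (2 * p - 2 * N i + 3)) -
          n / 2 * (-p * Real.log 2 - p + p * (Real.log n + Real.log (1 - 1 / n)) + (n - p - 3 / 2) * Lp)
      = (∑ i, p / 2 * (N i * Real.log (1 - 1 / N i)) + k * (p / 2) + (∑ i, ys i) / 4)
        - 1 / 2 * (n * (A - B)) + 3 / 4 * (n * (Lp - L)) := by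
    linear_combination (-1 / 2) * e5 - p / 2 * hA
  rw [e6]
  constructor <;> linarith [T1.1, T1.2, T2.1, T2.2, e4.1, e4.2]

lemma L_conv {l u : ℝ} (hl0 : 0 ≤ l) (hl1 : l ≤ 1) (hu0 : 0 ≤ u) (hu1 : u < 1) :
    l * (1 - l) * u ^ 2 / 2 ≤ l * (-Real.log (1 - u)) - (-Real.log (1 - l * u)) := by
  have hlu : l * u < 1 := by nlinarith
  have h1 := (Real.hasSum_pow_div_log_of_abs_lt_one (x := u) (by rwa [abs_of_nonneg hu0])).mul_left l
  have h2 := Real.hasSum_pow_div_log_of_abs_lt_one (x := l * u) (by rwa [abs_of_nonneg (by positivity)])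
  have h3 := h1.sub h2
  have := le_hasSum h3 1 (fun j _ => by
    rw [← mul_div_assoc, ← sub_div]
    apply div_nonneg _ (by positivity)
    rw [mul_pow, ← sub_mul]
    apply mul_nonneg _ (by positivity)
    have : l ^ (j + 1) ≤ l := pow_le_of_le_one hl0 hl1 (by omega)
    linarith)
  refine le_trans (le_of_eq ?_) this
  push_cast
  ring

lemma sig_bd {k : ℕ} (hk : 2 ≤ k) (p : ℝ) (N : Fin k → ℝ) (hp : 0 < p) (hN : ∀ i, p + 1 < N i) 
     (n : ℝ) (hn : n = ∑ i, N i) :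
    (1 / 4) * (p / n) ^ 2 ≤ (1 / 2) * ((∑ i, (N i ^ 2 / n ^ 2) * (-Real.log (1 - p / (N i - 1)))) - (-Real.log (1 - p / n))) := by
  have hN0 : ∀ i, 0 < N i := fun i => by linarith [hN i]
  have hn0 : 0 < n := by
    rw [hn]; exact Finset.sum_pos (fun i _ => hN0 i) ⟨⟨0, by omega⟩, Finset.mem_univ _⟩
  have key : ∀ i, N i / n * (-Real.log (1 - p / n)) + (1 - N i / n) * ((p / n) ^ 2 / 2) ≤
      (N i ^ 2 / n ^ 2) * (-Real.log (1 - p / (N i - 1))) := by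
    intro i
    have h0 := hN0 i
    have h1 : 0 < N i - 1 := by linarith [hN i]
    have hl1 : N i / n ≤ 1 := by
      rw [div_le_one hn0, hn]
      exact Finset.single_le_sum (f := N) (fun j _ => (hN0 j).le) (Finset.mem_univ i)
    have c := L_conv (l := N i / n) (u := p / N i) (by positivity) hl1 (by positivity)
      (by rw [div_lt_one h0]; linarith [hN i])
    have e : N i / n * (p / N i) = p / n := by field_simp
    rw [e] at c
    have c2 : -Real.log (1 - p / N i) ≤ -Real.log (1 - p / (N i - 1)) := by
      apply neg_le_neg
      apply Real.log_le_log
      · rw [sub_pos, div_lt_one h1]; linarith [hN i]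
      · have : p / N i ≤ p / (N i - 1) := div_le_div_of_nonneg_left hp.le h1 (by linarith)
        linarith
    have c3 := mul_le_mul_of_nonneg_left c (show 0 ≤ N i / n by positivity)
    have c4 := mul_le_mul_of_nonneg_left c2 (show 0 ≤ N i ^ 2 / n ^ 2 by positivity)
    have e2 : N i / n * (N i / n * (1 - N i / n) * (p / N i) ^ 2 / 2) = (1 - N i / n) * ((p / n) ^ 2 / 2) := by
      field_simp
    rw [e2] at c3
    have e3 : N i ^ 2 / n ^ 2 = N i / n * (N i / n) := by field_simp
    rw [e3] at c4 ⊢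
    linarith
  have hs := Finset.sum_le_sum fun i (_ : i ∈ Finset.univ) => key i
  rw [Finset.sum_add_distrib, ← Finset.sum_mul, ← Finset.sum_mul, Finset.sum_sub_distrib, ← Finset.sum_div, ← hn, div_self hn0.ne'] at hs
  simp only [Finset.sum_const, Finset.card_univ, Fintype.card_fin, nsmul_eq_mul, mul_one] at hs
  have hk' : (2 : ℝ) ≤ k := by exact_mod_cast hk
  have : (p / n) ^ 2 / 2 ≤ (k - 1) * ((p / n) ^ 2 / 2) := by nlinarith [show 0 ≤ (p / n) ^ 2 / 2 by positivity]
  linarith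

end asy
end JY

namespace JY
section lims

lemma lim_N {N : ℕ → ℕ} (h : ∀ p : ℕ, 1 ≤ p → p + 1 < N p) : Tendsto (fun p => (N p : ℝ)) atTop atTop := by
  apply tendsto_natCast_atTop_atTop.comp
  refine tendsto_atTop_mono' atTop ?_ tendsto_id
  filter_upwards [eventually_ge_atTop 1] with p hp
  have := h p hp
  simp only [id]
  omega

variable {k : ℕ} {nn : Fin k → ℕ → ℕ} {ys : Fin k → ℝ}

lemma lim_pn (hk : 2 ≤ k) (hys : ∀ i, ys i ∈ Set.Ioc (0 : ℝ) 1)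
    (hlim : ∀ i, Tendsto (fun p : ℕ => (p : ℝ) / nn i p) atTop (𝓝 (ys i))) :
    ∃ c > 0, Tendsto (fun p : ℕ => (p : ℝ) / ∑ i, (nn i p : ℝ)) atTop (𝓝 c) := by
  have h1 : Tendsto (fun p : ℕ => ∑ i, ((p : ℝ) / nn i p)⁻¹) atTop (𝓝 (∑ i, (ys i)⁻¹)) :=
    tendsto_finsetSum _ fun i _ => (hlim i).inv₀ (hys i).1.ne'
  have hpos : 0 < ∑ i, (ys i)⁻¹ := Finset.sum_pos (fun i _ => inv_pos.2 (hys i).1) ⟨⟨0, by omega⟩, Finset.mem_univ _⟩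
  refine ⟨_, inv_pos.2 hpos, (h1.inv₀ hpos.ne').congr fun p => ?_⟩
  simp only [inv_div]
  rw [← Finset.sum_div, inv_div]

lemma sum_ge (hk : 2 ≤ k) {p : ℕ} (N : Fin k → ℕ) (h : ∀ i, p + 1 < N i) : 2 * p + 4 ≤ ∑ i, N i := by
  calc 2 * p + 4 = 2 * (p + 2) := by ring
    _ ≤ k * (p + 2) := Nat.mul_le_mul_right _ hk
    _ = ∑ i : Fin k, (p + 2) := by simp
    _ ≤ _ := Finset.sum_le_sum fun i _ => h i

/-- σ blows up if some y_i = 1 -/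
lemma lim_sig (hk : 2 ≤ k) (hnn : ∀ (i : Fin k) (p : ℕ), 1 ≤ p → p + 1 < nn i p)
    (hys : ∀ i, ys i ∈ Set.Ioc (0 : ℝ) 1)
    (hlim : ∀ i, Tendsto (fun p : ℕ => (p : ℝ) / nn i p) atTop (𝓝 (ys i)))
    (i : Fin k) (hi : ys i = 1) :
    Tendsto (fun p : ℕ => (1 / 2) *
      ((∑ i, ((nn i p : ℝ) ^ 2 / (∑ i, (nn i p : ℝ)) ^ 2)
          * (-Real.log (1 - (p : ℝ) / ((nn i p : ℝ) - 1))))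
        - (-Real.log (1 - (p : ℝ) / (∑ i, (nn i p : ℝ)))))) atTop atTop := by
  obtain ⟨c, hc, hpn⟩ := lim_pn hk hys hlim
  have hNi := lim_N (hnn i)
  have h1 : Tendsto (fun p : ℕ => (p : ℝ) / ((nn i p : ℝ) - 1)) atTop (𝓝 1) := by
    have a : Tendsto (fun p : ℕ => (1 - (nn i p : ℝ)⁻¹)) atTop (𝓝 1) := by
      simpa using (tendsto_inv_atTop_zero.comp hNi).const_sub 1
    have b := (hlim i).div a one_ne_zero
    rw [hi, div_one] at b
    refine b.congr' ?_
    filter_upwards [eventually_ge_atTop 1] with p hp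
    have : (1 : ℝ) < nn i p := by exact_mod_cast (by have := hnn i p hp; omega : 1 < nn i p)
    have : (nn i p : ℝ) - 1 ≠ 0 := by linarith
    simp only [Pi.div_apply]
    field_simp
  have h2 : Tendsto (fun p : ℕ => -Real.log (1 - (p : ℝ) / ((nn i p : ℝ) - 1))) atTop atTop := by
    apply tendsto_neg_atBot_atTop.comp
    refine Real.tendsto_log_nhdsGT_zero.comp ?_
    rw [tendsto_nhdsWithin_iff]
    refine ⟨by simpa using h1.const_sub 1, ?_⟩
    filter_upwards [eventually_ge_atTop 1] with p hp
    have : (p : ℝ) + 1 < nn i p := by exact_mod_cast hnn i p hp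
    have h3 : 0 < (nn i p : ℝ) - 1 := by linarith [(Nat.cast_nonneg p : (0:ℝ) ≤ p)]
    rw [Set.mem_Ioi, sub_pos, div_lt_one h3]
    linarith
  have h3 : Tendsto (fun p : ℕ => (nn i p : ℝ) ^ 2 / (∑ i, (nn i p : ℝ)) ^ 2) atTop (𝓝 (c ^ 2)) := by
    have := (hpn.div (hlim i) (hys i).1.ne').pow 2
    rw [hi, div_one] at this
    refine this.congr' ?_
    filter_upwards [eventually_ge_atTop 1] with p hp
    have : (1 : ℝ) < nn i p := by exact_mod_cast (by have := hnn i p hp; omega : 1 < nn i p)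
    have : (p : ℝ) ≠ 0 := by exact_mod_cast (by omega)
    simp only [Pi.div_apply]
    rw [← div_pow]
    congr 1
    field_simp
  have h4 := (h3.pos_mul_atTop (by positivity) h2)
  have h5 := (tendsto_atTop_add_const_right _ (-Real.log 2) h4).const_mul_atTop (show (0:ℝ) < 1 / 2 by norm_num)
  refine tendsto_atTop_mono' _ ?_ h5
  filter_upwards [eventually_ge_atTop 1] with p hp
  have hp' : (1 : ℝ) ≤ p := by exact_mod_cast hp
  have hn : 2 * (p : ℝ) + 4 ≤ ∑ i, (nn i p : ℝ) := by exact_mod_cast sum_ge hk (fun i => nn i p) (fun i => hnn i p hp)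
  have b1 : -Real.log (1 - (p : ℝ) / (∑ i, (nn i p : ℝ))) ≤ Real.log 2 := by
    rw [← Real.log_inv]
    have : (p : ℝ) / (∑ i, (nn i p : ℝ)) ≤ 1 / 2 := by rw [div_le_iff₀ (by linarith)]; linarith
    apply Real.log_le_log
    · rw [inv_pos]; linarith
    · rw [inv_le_comm₀ (by linarith) (by norm_num)]; linarith
  have b2 : (nn i p : ℝ) ^ 2 / (∑ i, (nn i p : ℝ)) ^ 2 * (-Real.log (1 - (p : ℝ) / ((nn i p : ℝ) - 1)))
     ≤ ∑ i, ((nn i p : ℝ) ^ 2 / (∑ i, (nn i p : ℝ)) ^ 2) * (-Real.log (1 - (p : ℝ) / ((nn i p : ℝ) - 1))) := by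
    refine Finset.single_le_sum (f := fun i => ((nn i p : ℝ) ^ 2 / (∑ i, (nn i p : ℝ)) ^ 2) * (-Real.log (1 - (p : ℝ) / ((nn i p : ℝ) - 1)))) (fun j _ => ?_) (Finset.mem_univ i)
    apply mul_nonneg (by positivity)
    have h1 : (p : ℝ) + 1 < nn j p := by exact_mod_cast hnn j p hp
    have h3 : 0 < (nn j p : ℝ) - 1 := by linarith
    rw [neg_nonneg]
    apply Real.log_nonpos
    · rw [sub_nonneg, div_le_one h3]; linarith
    · linarith [div_nonneg (by linarith : (0:ℝ) ≤ p) h3.le]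
  linarith

lemma lim_d {N : ℕ → ℕ} {y : ℝ} (h : ∀ p : ℕ, 1 ≤ p → p + 1 < N p) (hy : y < 1)
    (hl : Tendsto (fun p : ℕ => (p : ℝ) / N p) atTop (𝓝 y)) :
    Tendsto (fun p : ℕ => (N p : ℝ) - 1 - p) atTop atTop := by
  have h1 := tendsto_atTop_add_const_right _ (-1) ((lim_N h).atTop_mul_pos (sub_pos.2 hy) (hl.const_sub 1))
  refine h1.congr' ?_
  filter_upwards [eventually_ge_atTop 1] with p hp
  have : (1 : ℝ) < N p := by exact_mod_cast (by have := h p hp; omega : 1 < N p)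
  field_simp
  ring

end lims
end JY

namespace JY
section fin
open Complex

lemma phi_id {k : ℕ} (Φ G : ℂ) (Gi : Fin k → ℂ) (m a s l : ℝ) (ai si li : Fin k → ℝ) (c th v : ℝ)
    (hG : Φ * G = cexp ((c : ℝ) * I) * ∏ i, Gi i)
    (hG0 : G * cexp (-((s * a : ℝ) * I) + (s ^ 2 * l : ℝ)) ≠ 0)
    (hth : th = c - m + (∑ i, si i * ai i) - s * a)
    (hv : v = (∑ i, si i ^ 2 * li i) - s ^ 2 * l) :
    cexp (-((m : ℝ) * I)) * Φ = (∏ i, (Gi i * cexp (-((si i * ai i : ℝ) * I) + (si i ^ 2 * li i : ℝ)))) /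
      (G * cexp (-((s * a : ℝ) * I) + (s ^ 2 * l : ℝ))) * cexp ((th : ℝ) * I - (v : ℝ)) := by
  rw [div_mul_eq_mul_div, eq_div_iff hG0, Finset.prod_mul_distrib, ← Complex.exp_sum]
  calc cexp (-((m : ℝ) * I)) * Φ * (G * cexp (-((s * a : ℝ) * I) + (s ^ 2 * l : ℝ)))
      = cexp (-((m : ℝ) * I)) * (Φ * G) * cexp (-((s * a : ℝ) * I) + (s ^ 2 * l : ℝ)) := by ring
    _ = (∏ i, Gi i) * (cexp (-((m : ℝ) * I)) * cexp ((c : ℝ) * I) * cexp (-((s * a : ℝ) * I) + (s ^ 2 * l : ℝ))) := by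
        rw [hG]; ring
    _ = _ := by
        rw [mul_assoc (∏ i, Gi i), ← Complex.exp_add, ← Complex.exp_add, ← Complex.exp_add]
        congr 2
        rw [Finset.sum_add_distrib, Finset.sum_neg_distrib, ← Finset.sum_mul, ← Complex.ofReal_sum, ← Complex.ofReal_sum, hth, hv]
        push_cast
        ring

variable {k : ℕ} {nn : Fin k → ℕ → ℕ} {ys : Fin k → ℝ}

lemma lim_sd (hk : 2 ≤ k) (hnn : ∀ (i : Fin k) (p : ℕ), 1 ≤ p → p + 1 < nn i p)
    (hys : ∀ i, ys i ∈ Set.Ioc (0 : ℝ) 1)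
    (hlim : ∀ i, Tendsto (fun p : ℕ => (p : ℝ) / nn i p) atTop (𝓝 (ys i)))
    (σsq : ℕ → ℝ)
    (hσ : ∀ p : ℕ, σsq p = (1 / 2) *
      ((∑ i, ((nn i p : ℝ) ^ 2 / (∑ i, (nn i p : ℝ)) ^ 2)
          * (-Real.log (1 - (p : ℝ) / ((nn i p : ℝ) - 1))))
        - (-Real.log (1 - (p : ℝ) / (∑ i, (nn i p : ℝ))))))
    (σ0 : ℝ) (h0 : 0 < σ0) (hs0 : ∀ᶠ p in atTop, σ0 ≤ Real.sqrt (σsq p)) (i : Fin k) :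
    Tendsto (fun p : ℕ => (Real.sqrt (σsq p))⁻¹ / ((nn i p - 1 - p : ℕ) : ℝ)) atTop (𝓝 0) := by
  have hc : ∀ p : ℕ, 1 ≤ p → ((nn i p - 1 - p : ℕ) : ℝ) = (nn i p : ℝ) - 1 - p := by
    intro p hp
    have := hnn i p hp
    rw [Nat.cast_sub (by omega), Nat.cast_sub (by omega), Nat.cast_one]
  by_cases hi : ys i = 1
  · have h1 := lim_sig hk hnn hys hlim i hi
    have h2 : Tendsto σsq atTop atTop := h1.congr fun p => (hσ p).symm
    have h3 := (tendsto_inv_atTop_zero.comp (Real.tendsto_sqrt_atTop.comp h2))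
    refine squeeze_zero' ?_ ?_ h3
    · exact Eventually.of_forall fun p => by positivity
    · filter_upwards [eventually_ge_atTop 1] with p hp
      apply div_le_self (by positivity)
      have := hnn i p hp
      exact_mod_cast (by omega : 1 ≤ nn i p - 1 - p)
  · have hd := lim_d (hnn i) (lt_of_le_of_ne (hys i).2 hi) (hlim i)
    have h3 := (tendsto_inv_atTop_zero.comp hd).const_mul σ0⁻¹
    rw [mul_zero] at h3
    refine squeeze_zero' (Eventually.of_forall fun p => by positivity) ?_ h3
    filter_upwards [eventually_ge_atTop 1, hs0] with p hp hs
    rw [div_eq_mul_inv, Function.comp_apply, ← hc p hp]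
    apply mul_le_mul_of_nonneg_right _ (by positivity)
    exact inv_anti₀ h0 hs

lemma near_lim (s : ℕ → ℝ) (d : ℕ → ℕ) (S : ℝ) (hd : ∀ᶠ p in atTop, 1 ≤ d p)
    (hS : ∀ᶠ p in atTop, |s p| ≤ S) (hl : Tendsto (fun p => |s p| / (d p : ℝ)) atTop (𝓝 0)) :
    Tendsto (fun p : ℕ => GR (s p) (d p) p * Complex.exp (-(((s p * phA (d p) p:ℝ):ℂ)*I) + ((s p^2*LL (d p) p:ℝ):ℂ)))
      atTop (𝓝 1) := by
  have h1 := hl.const_mul (KK S)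
  rw [mul_zero] at h1
  refine Near.tendsto ?_ h1
  filter_upwards [hd, hS, hl.eventually_le_const (show (0:ℝ) < 1 / 4 by norm_num)] with p h1 h2 h3
  apply GR_near h1 p h2
  have : (0 : ℝ) < d p := by exact_mod_cast h1
  rw [div_le_iff₀ this] at h3
  linarith

end fin
end JY

open JY

/-- Jiang–Yang, Theorem 3: CLT for the log likelihood ratio statistic for testing
that `k` `p`-variate normal distributions are identical, when `p/n_i → y_i ∈ (0,1]`.
Under the null the observations are i.i.d. `N_p(0, I_p)`, the variance parameter
`σ_n²` is strictly positive, and `(log Λ_n − μ_n)/(n σ_n) ⇒ N(0,1)`. -/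
theorem stmt_8 (k : ℕ) (hk : 2 ≤ k) (nn : Fin k → ℕ → ℕ)
    (hnn : ∀ (i : Fin k) (p : ℕ), 1 ≤ p → p + 1 < nn i p)
    (ys : Fin k → ℝ) (hys : ∀ i, ys i ∈ Set.Ioc (0 : ℝ) 1)
    (hlim : ∀ i, Tendsto (fun p : ℕ => (p : ℝ) / nn i p) atTop (𝓝 (ys i)))
    (μn σsq : ℕ → ℝ)
    (hμ : ∀ p : ℕ, μn p = (1 / 4) *
      (-2 * k * p - (∑ i, ys i)
        + (∑ i, (nn i p : ℝ)) * (-Real.log (1 - (p : ℝ) / (∑ i, (nn i p : ℝ))))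
            * (2 * p - 2 * (∑ i, (nn i p : ℝ)) + 3)
        - ∑ i, (nn i p : ℝ) * (-Real.log (1 - (p : ℝ) / ((nn i p : ℝ) - 1)))
            * (2 * p - 2 * (nn i p : ℝ) + 3)))
    (hσ : ∀ p : ℕ, σsq p = (1 / 2) *
      ((∑ i, ((nn i p : ℝ) ^ 2 / (∑ i, (nn i p : ℝ)) ^ 2)
          * (-Real.log (1 - (p : ℝ) / ((nn i p : ℝ) - 1))))
        - (-Real.log (1 - (p : ℝ) / (∑ i, (nn i p : ℝ)))))) :
    (∀ p : ℕ, 1 ≤ p → 0 < σsq p) ∧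
    ∀ f : BoundedContinuousFunction ℝ ℝ,
      Tendsto (fun p : ℕ =>
          ∫ ω : ((i : Fin k) × Fin (nn i p)) × Fin p → ℝ,
            f ((logIdenticalStat k p (fun i => nn i p) ω - μn p)
              / ((∑ i, (nn i p : ℝ)) * Real.sqrt (σsq p)))
            ∂(Measure.pi fun _ => gaussianReal 0 1))
        atTop (𝓝 (∫ x, f x ∂(gaussianReal 0 1))) := by
  have hNr : ∀ (i : Fin k) (p : ℕ), 1 ≤ p → (p : ℝ) + 1 < nn i p := fun i p hp => by exact_mod_cast hnn i p hp
  have hn4 : ∀ p : ℕ, 1 ≤ p → 2 * (p : ℝ) + 4 ≤ ∑ i, (nn i p : ℝ) := fun p hp => by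
    exact_mod_cast sum_ge hk (fun i => nn i p) (fun i => hnn i p hp)
  have hsig : ∀ p : ℕ, 1 ≤ p → (1 / 4) * ((p : ℝ) / ∑ i, (nn i p : ℝ)) ^ 2 ≤ σsq p := by
    intro p hp
    rw [hσ]
    exact sig_bd hk (p : ℝ) (fun i => (nn i p : ℝ)) (by exact_mod_cast hp) (fun i => hNr i p hp) _ rfl
  have hpos : ∀ p : ℕ, 1 ≤ p → 0 < σsq p := by
    intro p hp
    refine lt_of_lt_of_le ?_ (hsig p hp)
    have h1 : (0 : ℝ) < p := by exact_mod_cast hp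
    have := hn4 p hp
    have : (0 : ℝ) < ∑ i, (nn i p : ℝ) := by linarith
    positivity
  refine ⟨hpos, ?_⟩
  obtain ⟨c, hc, hpn⟩ := lim_pn hk hys hlim
  have hs0 : ∀ᶠ p in atTop, c / 4 ≤ Real.sqrt (σsq p) := by
    filter_upwards [eventually_ge_atTop 1, hpn.eventually_const_le (show c / 2 < c by linarith)] with p hp hp2
    apply Real.le_sqrt_of_sq_le
    refine le_trans ?_ (hsig p hp)
    nlinarith
  have hc4 : 0 < c / 4 := by positivity
  have hnT : Tendsto (fun p : ℕ => ∑ i, (nn i p : ℝ)) atTop atTop := by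
    refine tendsto_atTop_mono' atTop ?_ (tendsto_natCast_atTop_atTop (R := ℝ))
    filter_upwards [eventually_ge_atTop 1] with p hp
    have : (1 : ℝ) ≤ p := by exact_mod_cast hp
    linarith [hn4 p hp]
  -- reduce to characteristic functions
  have hmeas : ∀ p, Measurable fun ω : ((i : Fin k) × Fin (nn i p)) × Fin p → ℝ =>
      (logIdenticalStat k p (fun i => nn i p) ω - μn p) / ((∑ i, (nn i p : ℝ)) * Real.sqrt (σsq p)) := fun p =>
    ((stat_meas (fun i => nn i p) p).sub_const _).div_const _
  let P : ℕ → ProbabilityMeasure ℝ := fun p => ⟨(Measure.pi fun _ : ((i : Fin k) × Fin (nn i p)) × Fin p => gaussianReal 0 1).map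
    (fun ω => (logIdenticalStat k p (fun i => nn i p) ω - μn p) / ((∑ i, (nn i p : ℝ)) * Real.sqrt (σsq p))),
    Measure.isProbabilityMeasure_map (hmeas p).aemeasurable⟩
  let P0 : ProbabilityMeasure ℝ := ⟨gaussianReal 0 1, inferInstance⟩
  suffices hP : Tendsto P atTop (𝓝 P0) by
    intro f
    have := (ProbabilityMeasure.tendsto_iff_forall_integral_tendsto.1 hP) f
    refine this.congr fun p => ?_
    exact integral_map (hmeas p).aemeasurable f.continuous.measurable.aestronglyMeasurable
  rw [ProbabilityMeasure.tendsto_iff_tendsto_charFun]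
  intro t
  have hP0 : charFun (P0 : Measure ℝ) t = Complex.exp (((0 : ℝ) : ℂ) * Complex.I - ((t ^ 2 / 2 : ℝ) : ℂ)) := by
    change charFun (gaussianReal 0 1) t = _
    rw [charFun_gaussianReal]
    congr 1
    push_cast
    simp
  rw [hP0]
  -- parameters
  set n : ℕ → ℝ := fun p => ∑ i, (nn i p : ℝ) with hn
  set τ : ℕ → ℝ := fun p => t / (n p * Real.sqrt (σsq p)) with hτ
  have hchar : ∀ p, charFun (P p : Measure ℝ) t = Complex.exp (-((τ p * μn p : ℝ) * Complex.I)) *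
      ∫ ω, Complex.exp ((τ p * logIdenticalStat k p (fun i => nn i p) ω : ℝ) * Complex.I) ∂(Measure.pi fun _ => gaussianReal 0 1) := by
    intro p
    rw [charFun_apply_real]
    refine (integral_map (hmeas p).aemeasurable (by fun_prop)).trans ?_
    rw [← integral_const_mul]
    congr 1
    funext ω
    rw [← Complex.exp_add]
    congr 1
    simp only [hτ, hn]
    push_cast
    ring
  set d : ℕ → ℕ := fun p => ∑ i, nn i p - 1 - p with hd
  set di : Fin k → ℕ → ℕ := fun i p => nn i p - 1 - p with hdi
  have hdc : ∀ p, 1 ≤ p → (d p : ℝ) = n p - 1 - p := by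
    intro p hp
    have := sum_ge hk (fun i => nn i p) (fun i => hnn i p hp)
    simp only [hd, hn]
    rw [Nat.cast_sub (by omega), Nat.cast_sub (by omega), Nat.cast_one, Nat.cast_sum]
  have hdic : ∀ i p, 1 ≤ p → (di i p : ℝ) = nn i p - 1 - p := by
    intro i p hp
    have := hnn i p hp
    simp only [hdi]
    rw [Nat.cast_sub (by omega), Nat.cast_sub (by omega), Nat.cast_one]
  set s : ℕ → ℝ := fun p => τ p * n p / 2 with hs
  set si : Fin k → ℕ → ℝ := fun i p => τ p * nn i p / 2 with hsi
  have hsb : ∀ p, 1 ≤ p → |s p| = |t| / 2 * (Real.sqrt (σsq p))⁻¹ := by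
    intro p hp
    have h1 : 0 < n p := by have := hn4 p hp; have : (0:ℝ) ≤ p := Nat.cast_nonneg p; simp only [hn]; linarith
    have h2 := Real.sqrt_pos.2 (hpos p hp)
    have : s p = t / 2 * (Real.sqrt (σsq p))⁻¹ := by simp only [hs, hτ]; field_simp
    rw [this, abs_mul, abs_div, abs_of_pos (inv_pos.2 h2)]
    norm_num
  have hsib : ∀ i p, 1 ≤ p → |si i p| ≤ |t| / 2 * (Real.sqrt (σsq p))⁻¹ := by
    intro i p hp
    rw [← hsb p hp]
    simp only [hs, hsi, abs_div, abs_mul]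
    have : (nn i p : ℝ) ≤ n p := Finset.single_le_sum (f := fun i => (nn i p : ℝ)) (fun _ _ => Nat.cast_nonneg _) (Finset.mem_univ i)
    have h2 : |(nn i p : ℝ)| ≤ |n p| := abs_le_abs_of_nonneg (Nat.cast_nonneg _) this
    gcongr
  have hSb : ∀ᶠ p in atTop, |t| / 2 * (Real.sqrt (σsq p))⁻¹ ≤ |t| / 2 * (c / 4)⁻¹ := by
    filter_upwards [hs0] with p hp
    gcongr
  have hF : Tendsto (fun p : ℕ => GR (s p) (d p) p * Complex.exp (-(((s p * phA (d p) p:ℝ):ℂ)*Complex.I) + ((s p^2*LL (d p) p:ℝ):ℂ)))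
      atTop (𝓝 1) := by
    refine near_lim s d (|t| / 2 * (c / 4)⁻¹) ?_ ?_ ?_
    · filter_upwards [eventually_ge_atTop 1] with p hp
      have := sum_ge hk (fun i => nn i p) (fun i => hnn i p hp)
      simp only [hd]; omega
    · filter_upwards [eventually_ge_atTop 1, hSb] with p hp h2
      rw [hsb p hp]; exact h2
    · have := (tendsto_inv_atTop_zero.comp (tendsto_natCast_atTop_atTop (R := ℝ))).const_mul (|t| / 2 * (c / 4)⁻¹)
      rw [mul_zero] at this
      refine squeeze_zero' (Eventually.of_forall fun p => by positivity) ?_ this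
      filter_upwards [eventually_ge_atTop 1, hSb] with p hp h2
      have h3 := sum_ge hk (fun i => nn i p) (fun i => hnn i p hp)
      rw [hsb p hp, div_eq_mul_inv, Function.comp_apply]
      have h5 : (p : ℝ) ≤ d p := by
        have : p ≤ d p := by simp only [hd]; omega
        exact_mod_cast this
      have h6 : (0 : ℝ) < p := by exact_mod_cast hp
      gcongr
  have hFi : ∀ i, Tendsto (fun p : ℕ => GR (si i p) (di i p) p * Complex.exp (-(((si i p * phA (di i p) p:ℝ):ℂ)*Complex.I) + ((si i p^2*LL (di i p) p:ℝ):ℂ)))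
      atTop (𝓝 1) := by
    intro i
    refine near_lim (si i) (di i) (|t| / 2 * (c / 4)⁻¹) ?_ ?_ ?_
    · filter_upwards [eventually_ge_atTop 1] with p hp
      have := hnn i p hp
      simp only [hdi]; omega
    · filter_upwards [eventually_ge_atTop 1, hSb] with p hp h2
      exact (hsib i p hp).trans h2
    · have := (lim_sd hk hnn hys hlim σsq hσ (c / 4) hc4 hs0 i).const_mul (|t| / 2)
      rw [mul_zero] at this
      refine squeeze_zero' (Eventually.of_forall fun p => by positivity) ?_ this
      filter_upwards [eventually_ge_atTop 1] with p hp
      rw [← mul_div_assoc]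
      exact div_le_div_of_nonneg_right (hsib i p hp) (Nat.cast_nonneg _)
  have hFp := tendsto_finsetProd Finset.univ fun i _ => hFi i
  have hQ := hFp.div hF one_ne_zero
  rw [Finset.prod_const_one, div_one] at hQ
  set th : ℕ → ℝ := fun p => τ p * kst (fun i => nn i p) p - τ p * μn p + (∑ i, si i p * phA (di i p) p) - s p * phA (d p) p with hth
  set v : ℕ → ℝ := fun p => (∑ i, si i p ^ 2 * LL (di i p) p) - s p ^ 2 * LL (d p) p with hv
  have hτ0 : Tendsto (fun p => |τ p| * (2 * k + 7)) atTop (𝓝 0) := by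
    have h1 := (tendsto_inv_atTop_zero.comp hnT).const_mul (|t| * (c / 4)⁻¹ * (2 * k + 7))
    rw [mul_zero] at h1
    refine squeeze_zero' (Eventually.of_forall fun p => by positivity) ?_ h1
    filter_upwards [eventually_ge_atTop 1, hs0] with p hp h2
    have h3 : 0 < n p := by have := hn4 p hp; have : (0:ℝ) ≤ p := Nat.cast_nonneg p; simp only [hn]; linarith
    have h4 := Real.sqrt_pos.2 (hpos p hp)
    have e : |τ p| = |t| * (Real.sqrt (σsq p))⁻¹ * (n p)⁻¹ := by
      simp only [hτ]
      rw [abs_div, abs_of_pos (mul_pos h3 h4)]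
      field_simp
    rw [e, Function.comp_apply]
    have : |t| * (Real.sqrt (σsq p))⁻¹ ≤ |t| * (c / 4)⁻¹ := by gcongr
    have h5 : |t| * (Real.sqrt (σsq p))⁻¹ * ((n p)⁻¹ * (2 * k + 7)) ≤ |t| * (c / 4)⁻¹ * ((n p)⁻¹ * (2 * k + 7)) :=
      mul_le_mul_of_nonneg_right this (by positivity)
    linarith
  have hth0 : Tendsto th atTop (𝓝 0) := by
    refine squeeze_zero_norm' ?_ hτ0
    filter_upwards [eventually_ge_atTop 1] with p hp
    have hb := theta_bd (p : ℝ) (fun i => (nn i p : ℝ)) ys (Nat.cast_nonneg p) (fun i => hNr i p hp)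
      (fun i => by have := hNr i p hp; have : (1:ℝ) ≤ p := by exact_mod_cast hp
                   linarith) hys (n p) rfl (hn4 p hp)
    have e : th p = τ p * ((p * n p / 2 * Real.log (n p) - ∑ i, p * (nn i p : ℝ) / 2 * Real.log (nn i p))
      - (1 / 4) * (-2 * k * p - (∑ i, ys i) + n p * (-Real.log (1 - p / n p)) * (2 * p - 2 * n p + 3)
        - ∑ i, (nn i p : ℝ) * (-Real.log (1 - p / (nn i p - 1))) * (2 * p - 2 * nn i p + 3))
      + (∑ i, (nn i p : ℝ) / 2 * phA (nn i p - 1 - p) p) - n p / 2 * phA (n p - 1 - p) p) := by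
      have eS : ∑ i, si i p * phA (di i p) p = τ p * ∑ i, (nn i p : ℝ) / 2 * phA (nn i p - 1 - p) p := by
        rw [Finset.mul_sum]
        refine Finset.sum_congr rfl fun i _ => ?_
        rw [hdic i p hp]
        simp only [hsi]
        ring
      have ek : kst (fun i => nn i p) p = p * n p / 2 * Real.log (n p) - ∑ i, p * (nn i p : ℝ) / 2 * Real.log (nn i p) := rfl
      have em : μn p = (1 / 4) * (-2 * k * p - (∑ i, ys i) + n p * (-Real.log (1 - p / n p)) * (2 * p - 2 * n p + 3)
        - ∑ i, (nn i p : ℝ) * (-Real.log (1 - p / (nn i p - 1))) * (2 * p - 2 * nn i p + 3)) := hμ p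
      have es : s p = τ p * n p / 2 := rfl
      have et : th p = τ p * kst (fun i => nn i p) p - τ p * μn p + (∑ i, si i p * phA (di i p) p) - s p * phA (d p) p := rfl
      rw [et, eS, ek, em, es, hdc p hp]
      ring
    rw [e, Real.norm_eq_abs, abs_mul]
    exact mul_le_mul_of_nonneg_left hb (abs_nonneg _)
  have hv0 : Tendsto v atTop (𝓝 (t ^ 2 / 2)) := by
    rw [tendsto_iff_norm_sub_tendsto_zero]
    have h1 := (tendsto_inv_atTop_zero.comp hnT).const_mul (6 * t ^ 2 / (4 * (c / 4) ^ 2))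
    rw [mul_zero] at h1
    refine squeeze_zero' (Eventually.of_forall fun p => norm_nonneg _) ?_ h1
    filter_upwards [eventually_ge_atTop 1, hs0] with p hp h2
    have h3 : 0 < n p := by have := hn4 p hp; have : (0:ℝ) ≤ p := Nat.cast_nonneg p; simp only [hn]; linarith
    have h4 := hpos p hp
    have hb := LL_diff_bd (Nat.cast_nonneg p) (hn4 p hp)
    have e0 : ∑ i, (nn i p : ℝ) ^ 2 * LL (nn i p - 1 - p) p = n p ^ 2 * (2 * σsq p + -Real.log (1 - p / n p)) := by
      have e1 : n p ^ 2 * (∑ i, ((nn i p : ℝ) ^ 2 / (n p) ^ 2) * (-Real.log (1 - (p : ℝ) / ((nn i p : ℝ) - 1)))) =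
        ∑ i, (nn i p : ℝ) ^ 2 * LL (nn i p - 1 - p) p := by
        rw [Finset.mul_sum]
        refine Finset.sum_congr rfl fun i _ => ?_
        rw [LL_eq (Nat.cast_nonneg p) (hNr i p hp)]
        field_simp
      rw [← e1, hσ p]
      ring
    have e : v p - t ^ 2 / 2 = - (t ^ 2 / (4 * σsq p)) * ((n p)⁻¹ * (n p * (LL (n p - 1 - p) p - -Real.log (1 - p / n p)))) := by
      have e2 : v p = τ p ^ 2 / 4 * (∑ i, (nn i p : ℝ) ^ 2 * LL (nn i p - 1 - p) p - n p ^ 2 * LL (n p - 1 - p) p) := by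
        have eS : ∑ i, si i p ^ 2 * LL (di i p) p = τ p ^ 2 / 4 * ∑ i, (nn i p : ℝ) ^ 2 * LL (nn i p - 1 - p) p := by
          rw [Finset.mul_sum]
          refine Finset.sum_congr rfl fun i _ => ?_
          rw [hdic i p hp]
          simp only [hsi]
          ring
        have es : s p = τ p * n p / 2 := rfl
        have et : v p = (∑ i, si i p ^ 2 * LL (di i p) p) - s p ^ 2 * LL (d p) p := rfl
        rw [et, eS, es, hdc p hp]
        ring
      have e3 : τ p ^ 2 = t ^ 2 / (n p ^ 2 * σsq p) := by
        simp only [hτ]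
        rw [div_pow, mul_pow, Real.sq_sqrt h4.le]
      rw [e2, e3, e0]
      field_simp
      ring
    rw [e, Real.norm_eq_abs, abs_mul, abs_mul, abs_neg, abs_of_nonneg (by positivity : 0 ≤ t ^ 2 / (4 * σsq p)), abs_of_pos (inv_pos.2 h3),
      Function.comp_apply]
    have h6 : t ^ 2 / (4 * σsq p) ≤ t ^ 2 / (4 * (c / 4) ^ 2) := by
      have : (c / 4) ^ 2 ≤ σsq p := by
        have := pow_le_pow_left₀ hc4.le h2 2
        rwa [Real.sq_sqrt h4.le] at this
      gcongr
    calc t ^ 2 / (4 * σsq p) * ((n p)⁻¹ * |n p * (LL (n p - 1 - p) p - -Real.log (1 - p / n p))|)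
        ≤ t ^ 2 / (4 * (c / 4) ^ 2) * ((n p)⁻¹ * 6) := by gcongr
      _ = _ := by simp only [hn]; ring
  have hE : Tendsto (fun p => Complex.exp ((th p : ℂ) * Complex.I - (v p : ℂ))) atTop
      (𝓝 (Complex.exp (((0 : ℝ) : ℂ) * Complex.I - ((t ^ 2 / 2 : ℝ) : ℂ)))) := by
    refine (Complex.continuous_exp.tendsto _).comp (Tendsto.sub (Tendsto.mul_const _ ?_) ?_)
    · exact (Complex.continuous_ofReal.tendsto _).comp hth0
    · exact (Complex.continuous_ofReal.tendsto _).comp hv0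
  have hQE := hQ.mul hE
  rw [one_mul] at hQE
  refine hQE.congr' ?_
  filter_upwards [eventually_ge_atTop 1, hF.eventually_ne one_ne_zero] with p hp hne
  rw [hchar]
  exact (phi_id _ _ (fun i => GR (si i p) (di i p) p) (τ p * μn p) (phA (d p) p) (s p) (LL (d p) p)
    (fun i => phA (di i p) p) (fun i => si i p) (fun i => LL (di i p) p) (τ p * kst (fun i => nn i p) p) (th p) (v p)
    (char_stat (fun i => nn i p) p (by omega) (fun i => hnn i p hp) (τ p)) hne rfl rfl).symm
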